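/- Suppose K is closed at infinity and f ∈ ℝ + int(P_d(K)), i.e., f − c lies in the interior of P_d(K) for some c ∈ ℝ (in particular the optimal value f_min of (POP) is finite). If the LICQC, SCC and SOSC hold at every global minimizer of the problem (H): minimize f̃(x̃) − f_min·x_0^d subject to c̃_j(x̃) = 0 (j∈E), ‖x̃‖² − 1 = 0, c̃_j(x̃) ≥ 0 (j∈I), x_0 ≥ 0, then there exists k0 ∈ ℕ such that f_k = f'_k = f_min for all k ≥ k0; moreover, there exists k1 ∈ ℕ such that for every k ≥ k1, every minimizer of the kth homogenized moment relaxation has a flat truncation. -/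

import Mathlib

open MvPolynomial MeasureTheory

noncomputable section

/-- The space of real polynomials in `n` variables. -/
abbrev RPoly (n : ℕ) : Type := MvPolynomial (Fin n) ℝ

/-- The degree `|α|` of a monomial power `α`. -/
def mdeg {n : ℕ} (α : Fin n →₀ ℕ) : ℕ := ∑ i, α i

/-- `p` is a sum of squares of polynomials. -/
def IsSOS {n : ℕ} (p : RPoly n) : Prop :=
  ∃ L : List (RPoly n), p = (L.map (fun q => q ^ 2)).sum

/-- The truncation `QM(g)_k` of the quadratic module generated by `(g j)_{j ∈ S}`. -/
def QModDeg {n : ℕ} {κ : Type} (S : Finset κ) (g : κ → RPoly n) (k : ℕ) :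
    Set (RPoly n) :=
  {p | ∃ σ0 : RPoly n, ∃ σ : κ → RPoly n,
      IsSOS σ0 ∧ σ0.totalDegree ≤ k ∧
      (∀ j ∈ S, IsSOS (σ j) ∧ (σ j).totalDegree + (g j).totalDegree ≤ k) ∧
      p = σ0 + ∑ j ∈ S, g j * σ j}

/-- The truncation `Ideal(h)_k` of the ideal generated by `(h j)_{j ∈ S}`. -/
def IdealDeg {n : ℕ} {ι : Type} (S : Finset ι) (h : ι → RPoly n) (k : ℕ) :
    Set (RPoly n) :=
  {p | ∃ q : ι → RPoly n,
      (∀ j ∈ S, (q j).totalDegree + (h j).totalDegree ≤ k) ∧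
      p = ∑ j ∈ S, h j * q j}

/-- The quadratic module `QM(g)` generated by `(g j)_{j ∈ S}`. -/
def QModFull {n : ℕ} {κ : Type} (S : Finset κ) (g : κ → RPoly n) : Set (RPoly n) :=
  {p | ∃ σ0 : RPoly n, ∃ σ : κ → RPoly n,
      IsSOS σ0 ∧ (∀ j ∈ S, IsSOS (σ j)) ∧ p = σ0 + ∑ j ∈ S, g j * σ j}

/-- The ideal `Ideal(h)` generated by `(h j)_{j ∈ S}`. -/
def IdealFull {n : ℕ} {ι : Type} (S : Finset ι) (h : ι → RPoly n) : Set (RPoly n) :=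
  (Ideal.span (h '' (S : Set ι)) : Ideal (RPoly n))

/-- `Ideal(c_eq) + QM(c_in)` is archimedean. -/
def ArchimedeanQM {n : ℕ} (E I : Finset ℕ) (c : ℕ → RPoly n) : Prop :=
  ∃ R : ℝ, 0 < R ∧ ∃ p1 ∈ IdealFull E c, ∃ p2 ∈ QModFull I c,
    (C R : RPoly n) - ∑ i, (X i : RPoly n) ^ 2 = p1 + p2

/-- The basic closed semialgebraic set `K`. -/
def Kset {n : ℕ} (E I : Finset ℕ) (c : ℕ → RPoly n) : Set (Fin n → ℝ) :=
  {x | (∀ j ∈ E, eval x (c j) = 0) ∧ (∀ j ∈ I, 0 ≤ eval x (c j))}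

/-- The bilinear pairing `⟨p, y⟩ = ∑_α p_α y_α`. -/
def pairing {n : ℕ} (p : RPoly n) (y : (Fin n →₀ ℕ) → ℝ) : ℝ :=
  ∑ α ∈ p.support, p.coeff α * y α

/-- Membership in the moment cone `ℛ_d(K)`: the entries `y_α`, `|α| ≤ d`, are the
moments of a finite Borel measure supported in the closed set `K`. -/
def InMomentCone {n : ℕ} (d : ℕ) (K : Set (Fin n → ℝ)) (y : (Fin n →₀ ℕ) → ℝ) : Prop :=
  ∃ μ : Measure (Fin n → ℝ), IsFiniteMeasure μ ∧ μ Kᶜ = 0 ∧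
    ∀ α : Fin n →₀ ℕ, mdeg α ≤ d →
      Integrable (fun x => ∏ i, x i ^ α i) μ ∧
      y α = ∫ x, (∏ i, x i ^ α i) ∂μ

/-- The cone `P_d(K)` of polynomials of degree at most `d` that are nonnegative on `K`. -/
def PdCone {n : ℕ} (d : ℕ) (K : Set (Fin n → ℝ)) : Set (RPoly n) :=
  {p | p.totalDegree ≤ d ∧ ∀ x ∈ K, 0 ≤ eval x p}

/-- The interior of `P_d(K)` in the coefficient topology of `ℝ[x]_d`. -/
def PdInterior {n : ℕ} (d : ℕ) (K : Set (Fin n → ℝ)) : Set (RPoly n) :=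
  {p | p.totalDegree ≤ d ∧ ∃ ε : ℝ, 0 < ε ∧ ∀ q : RPoly n, q.totalDegree ≤ d →
      (∀ α : Fin n →₀ ℕ, |q.coeff α - p.coeff α| ≤ ε) → ∀ x ∈ K, 0 ≤ eval x q}

instance degLEFintype (n t : ℕ) : Fintype {α : Fin n →₀ ℕ // mdeg α ≤ t} := by
  apply Fintype.ofInjective
    (fun a : {α : Fin n →₀ ℕ // mdeg α ≤ t} =>
      (fun i => (⟨a.1 i, by
        have h1 : a.1 i ≤ mdeg a.1 :=
          Finset.single_le_sum (fun j _ => Nat.zero_le _) (Finset.mem_univ i)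
        exact Nat.lt_succ_of_le (le_trans h1 a.2)⟩ : Fin (t + 1))) :
        {α : Fin n →₀ ℕ // mdeg α ≤ t} → (Fin n → Fin (t + 1)))
  intro a b hab
  apply Subtype.ext
  ext i
  exact congrArg Fin.val (congrFun hab i)

/-- The moment matrix `M_t[w]`, indexed by monomial powers of degree at most `t`. -/
def momentMatrix {n : ℕ} (t : ℕ) (w : (Fin n →₀ ℕ) → ℝ) :
    Matrix {α : Fin n →₀ ℕ // mdeg α ≤ t} {α : Fin n →₀ ℕ // mdeg α ≤ t} ℝ :=
  fun α β => w (α.1 + β.1)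

/-- `w` admits a flat truncation: for some `d0 ≤ t ≤ k`,
`rank M_{t-dK}[w] = rank M_t[w]`. -/
def HasFlatTruncation {n : ℕ} (d0 dK k : ℕ) (w : (Fin n →₀ ℕ) → ℝ) : Prop :=
  ∃ t : ℕ, d0 ≤ t ∧ t ≤ k ∧
    (momentMatrix (t - dK) w).rank = (momentMatrix t w).rank

/-- The gradient of a polynomial at a point. -/
def gradP {n : ℕ} (p : RPoly n) (u : Fin n → ℝ) : Fin n → ℝ :=
  fun i => eval u (pderiv i p)

/-- The Hessian of a polynomial at a point. -/
def hessP {n : ℕ} (p : RPoly n) (u : Fin n → ℝ) : Fin n → Fin n → ℝ :=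
  fun i j => eval u (pderiv i (pderiv j p))

/-- The classical optimality conditions (LICQC, KKT with SCC and SOSC) at the point `u`
for the problem: minimize `F` subject to `ge j = 0` (`j ∈ Es`), `gi j ≥ 0` (`j ∈ Is`). -/
def OptCondsAt {n : ℕ} {ι κ : Type}
    (Es : Finset ι) (ge : ι → RPoly n) (Is : Finset κ) (gi : κ → RPoly n)
    (F : RPoly n) (u : Fin n → ℝ) : Prop :=
  -- LICQC: gradients of active constraints are linearly independent
  LinearIndependent ℝ
    (Sum.elim
      (fun j : {j : ι // j ∈ Es ∧ eval u (ge j) = 0} => gradP (ge j.1) u)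
      (fun j : {j : κ // j ∈ Is ∧ eval u (gi j) = 0} => gradP (gi j.1) u)) ∧
  ∃ (lamE : ι → ℝ) (lamI : κ → ℝ),
    -- KKT stationarity
    (gradP F u =
      (∑ j ∈ Es, lamE j • gradP (ge j) u) + ∑ j ∈ Is, lamI j • gradP (gi j) u) ∧
    (∀ j ∈ Is, 0 ≤ lamI j ∧ lamI j * eval u (gi j) = 0) ∧
    -- SCC
    (∀ j ∈ Is, 0 < lamI j + eval u (gi j)) ∧
    -- SOSC
    (∀ v : Fin n → ℝ, v ≠ 0 →
      (∀ j ∈ Es, (∑ i, v i * gradP (ge j) u i) = 0) →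
      (∀ j ∈ Is, eval u (gi j) = 0 → (∑ i, v i * gradP (gi j) u i) = 0) →
      0 < ∑ i, ∑ i', v i *
        ((hessP F u i i' - ∑ j ∈ Es, lamE j * hessP (ge j) u i i')
          - ∑ j ∈ Is, lamI j * hessP (gi j) u i i') * v i')

/-- The degree-`ℓ` homogenization `x_0^ℓ p(x/x_0)` of `p`; the new variable `x_0`
is the variable of index `0` in `Fin (n+1)`. -/
def homogAux {n : ℕ} (ℓ : ℕ) (p : RPoly n) : RPoly (n + 1) :=
  ∑ α ∈ p.support,
    monomial
      (Finsupp.single (0 : Fin (n + 1)) (ℓ - mdeg α) + Finsupp.mapDomain Fin.succ α)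
      (p.coeff α)

/-- The homogenization `p̃` of `p`. -/
def homogenize {n : ℕ} (p : RPoly n) : RPoly (n + 1) := homogAux p.totalDegree p

/-- The polynomial `‖x̃‖² - 1`. -/
def sphereP (n : ℕ) : RPoly (n + 1) := (∑ i, (X i : RPoly (n + 1)) ^ 2) - 1

/-- The homogenization `K̃` of the set `K`. -/
def Khom {n : ℕ} (E I : Finset ℕ) (c : ℕ → RPoly n) : Set (Fin (n + 1) → ℝ) :=
  {x | (∀ j ∈ E, eval x (homogenize (c j)) = 0) ∧
       (∀ j ∈ I, 0 ≤ eval x (homogenize (c j))) ∧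
       (∑ i, (x i) ^ 2) = 1 ∧ 0 ≤ x 0}

/-- `K` is closed at infinity. -/
def ClosedAtInfinity {n : ℕ} (E I : Finset ℕ) (c : ℕ → RPoly n) : Prop :=
  Khom E I c = closure (Khom E I c ∩ {x | 0 < x 0})

/-- The tuple `c̃_eq`: the homogenizations `c̃_j` together with `‖x̃‖² - 1`
(the latter indexed by `none`). -/
def gEqH {n : ℕ} (c : ℕ → RPoly n) : Option ℕ → RPoly (n + 1) :=
  fun o => o.elim (sphereP n) (fun j => homogenize (c j))

/-- The tuple `c̃_in`: the homogenizations `c̃_j` together with `x_0`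
(the latter indexed by `none`). -/
def gInH {n : ℕ} (c : ℕ → RPoly n) : Option ℕ → RPoly (n + 1) :=
  fun o => o.elim (X 0) (fun j => homogenize (c j))

/-- The index set of a tuple extended by one extra entry (indexed by `none`). -/
def OS (S : Finset ℕ) : Finset (Option ℕ) := insert none (S.image some)

/-- Feasibility of `θ` for the linear conic problem (P). -/
def PFeas {n m : ℕ} (m1 d : ℕ) (f : RPoly n) (a : Fin m → RPoly n)
    (K : Set (Fin n → ℝ)) (θ : Fin m → ℝ) : Prop :=
  (∀ i : Fin m, m1 ≤ (i : ℕ) → 0 ≤ θ i) ∧ (f - ∑ i, C (θ i) * a i) ∈ PdCone d K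

/-- The optimal value `ϑ*` of the linear conic problem (P). -/
def PVal {n m : ℕ} (m1 d : ℕ) (f : RPoly n) (a : Fin m → RPoly n) (b : Fin m → ℝ)
    (K : Set (Fin n → ℝ)) : ℝ :=
  sSup {v : ℝ | ∃ θ : Fin m → ℝ, PFeas m1 d f a K θ ∧ v = ∑ i, b i * θ i}

/-- Feasibility of `y` for the generalized moment problem (M). -/
def MFeas {n m : ℕ} (m1 d : ℕ) (a : Fin m → RPoly n) (b : Fin m → ℝ)
    (K : Set (Fin n → ℝ)) (y : (Fin n →₀ ℕ) → ℝ) : Prop :=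
  InMomentCone d K y ∧
  (∀ i : Fin m, (i : ℕ) < m1 → pairing (a i) y = b i) ∧
  (∀ i : Fin m, m1 ≤ (i : ℕ) → b i ≤ pairing (a i) y)

/-- The optimal value `φ*` of the generalized moment problem (M). -/
def MVal {n m : ℕ} (m1 d : ℕ) (f : RPoly n) (a : Fin m → RPoly n) (b : Fin m → ℝ)
    (K : Set (Fin n → ℝ)) : ℝ :=
  sInf {v : ℝ | ∃ y : (Fin n →₀ ℕ) → ℝ, MFeas m1 d a b K y ∧ v = pairing f y}

/-- The optimal value `ϑ_k` of the `k`th SOS relaxation of (P). -/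
def SOSRelaxVal {n m : ℕ} {ι κ : Type} (m1 : ℕ) (f : RPoly n) (a : Fin m → RPoly n)
    (b : Fin m → ℝ) (Es : Finset ι) (ge : ι → RPoly n) (Is : Finset κ) (gi : κ → RPoly n)
    (k : ℕ) : ℝ :=
  sSup {v : ℝ | ∃ θ : Fin m → ℝ, (∀ i : Fin m, m1 ≤ (i : ℕ) → 0 ≤ θ i) ∧
      (∃ p1 ∈ IdealDeg Es ge (2 * k), ∃ p2 ∈ QModDeg Is gi (2 * k),
        f - ∑ i, C (θ i) * a i = p1 + p2) ∧
      v = ∑ i, b i * θ i}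

/-- The semidefinite constraints of the `k`th moment relaxation:
the localizing vectors of the equality constraints vanish, and the localizing
matrices of the inequality constraints and the moment matrix are positive
semidefinite (stated equivalently via the associated quadratic forms). -/
def MomRelaxPSD {n : ℕ} {ι κ : Type} (Es : Finset ι) (ge : ι → RPoly n)
    (Is : Finset κ) (gi : κ → RPoly n) (k : ℕ) (w : (Fin n →₀ ℕ) → ℝ) : Prop :=
  (∀ j ∈ Es, ∀ p : RPoly n, p.totalDegree + (ge j).totalDegree ≤ 2 * k →
      pairing (ge j * p) w = 0) ∧
  (∀ j ∈ Is, ∀ p : RPoly n, p.totalDegree + ((gi j).totalDegree + 1) / 2 ≤ k →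
      0 ≤ pairing (gi j * p ^ 2) w) ∧
  (∀ p : RPoly n, p.totalDegree ≤ k → 0 ≤ pairing (p ^ 2) w)

/-- Feasibility of `w` for the `k`th moment relaxation of (M). -/
def GMomFeas {n m : ℕ} {ι κ : Type} (m1 : ℕ) (a : Fin m → RPoly n) (b : Fin m → ℝ)
    (Es : Finset ι) (ge : ι → RPoly n) (Is : Finset κ) (gi : κ → RPoly n) (k : ℕ)
    (w : (Fin n →₀ ℕ) → ℝ) : Prop :=
  (∀ i : Fin m, (i : ℕ) < m1 → pairing (a i) w = b i) ∧
  (∀ i : Fin m, m1 ≤ (i : ℕ) → b i ≤ pairing (a i) w) ∧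
  MomRelaxPSD Es ge Is gi k w

/-- The optimal value `φ_k` of the `k`th moment relaxation of (M). -/
def GMomVal {n m : ℕ} {ι κ : Type} (m1 : ℕ) (f : RPoly n) (a : Fin m → RPoly n)
    (b : Fin m → ℝ) (Es : Finset ι) (ge : ι → RPoly n) (Is : Finset κ) (gi : κ → RPoly n)
    (k : ℕ) : ℝ :=
  sInf {v : ℝ | ∃ w : (Fin n →₀ ℕ) → ℝ,
      GMomFeas m1 a b Es ge Is gi k w ∧ v = pairing f w}

/-- The optimal value `f_k^den` of the `k`th order relaxation with denominators. -/
def DenRelaxVal {n : ℕ} (E I : Finset ℕ) (c : ℕ → RPoly n) (f : RPoly n) (d k : ℕ) : ℝ :=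
  sSup {γ : ℝ | ∃ p1 ∈ IdealDeg E c (2 * k + d), ∃ p2 ∈ QModDeg I c (2 * k + d),
      (1 + ∑ i, (X i : RPoly n) ^ 2) ^ k * (f - C γ) = p1 + p2}


/-- The degree bound `d_K = max_j ⌈deg(c_j)/2⌉`. -/
def dKOrig {n : ℕ} (E I : Finset ℕ) (c : ℕ → RPoly n) : ℕ :=
  (E ∪ I).sup fun j => ((c j).totalDegree + 1) / 2

/-- The degree bound `d_0` for the GMP relaxations. -/
def d0GMP {n m : ℕ} (f : RPoly n) (a : Fin m → RPoly n) (E I : Finset ℕ)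
    (c : ℕ → RPoly n) : ℕ :=
  max ((f.totalDegree + 1) / 2)
    (max (dKOrig E I c) (Finset.univ.sup fun i : Fin m => ((a i).totalDegree + 1) / 2))

/-- The degree bound `d̃_K` for the homogenized constraining tuples. -/
def dKHom {n : ℕ} (E I : Finset ℕ) (c : ℕ → RPoly n) : ℕ :=
  max ((OS E).sup fun o => ((gEqH c o).totalDegree + 1) / 2)
      ((OS I).sup fun o => ((gInH c o).totalDegree + 1) / 2)

end

section PartA
variable {N : ℕ}

noncomputable def linP (u : Fin N → ℝ) (a : Fin N) : RPoly N := X a - C (u a)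

noncomputable def mI (u : Fin N → ℝ) : Ideal (RPoly N) := Ideal.span (Set.range (linP u))

lemma linP_mem (u : Fin N → ℝ) (a : Fin N) : linP u a ∈ mI u :=
  Ideal.subset_span ⟨a, rfl⟩

lemma eval_linP (u x : Fin N → ℝ) (a : Fin N) : eval x (linP u a) = x a - u a := by
  simp [linP]

lemma eval_of_mem_mI {u : Fin N → ℝ} {p : RPoly N} (h : p ∈ mI u) : eval u p = 0 := by
  have : mI u ≤ RingHom.ker (eval u) := by
    rw [mI, Ideal.span_le]
    rintro _ ⟨a, rfl⟩
    simp [RingHom.mem_ker, eval_linP]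
  exact this h

lemma sub_C_mem_mI (u : Fin N → ℝ) (p : RPoly N) : p - C (eval u p) ∈ mI u := by
  induction p using MvPolynomial.induction_on with
  | C a => simp
  | add p q hp hq =>
    have := (mI u).add_mem hp hq
    convert this using 1
    simp only [map_add]; ring
  | mul_X p i hp =>
    have h1 := (mI u).mul_mem_right (X i) hp
    have h2 := (mI u).mul_mem_left (C (eval u p)) (linP_mem u i)
    convert (mI u).add_mem h1 h2 using 1
    simp only [map_mul, eval_X, linP]; ring

lemma mem_mI {u : Fin N → ℝ} {p : RPoly N} : p ∈ mI u ↔ eval u p = 0 := by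
  refine ⟨eval_of_mem_mI, fun h => ?_⟩
  have := sub_C_mem_mI u p
  simpa [h] using this

lemma mI_coprime {u v : Fin N → ℝ} (h : u ≠ v) : IsCoprime (mI u) (mI v) := by
  obtain ⟨a, ha⟩ := Function.ne_iff.mp h
  rw [Ideal.isCoprime_iff_exists]
  have hne : v a - u a ≠ 0 := fun h0 => ha (by linarith)
  refine ⟨C ((v a - u a)⁻¹) * linP u a, (mI u).mul_mem_left _ (linP_mem u a),
    - C ((v a - u a)⁻¹) * linP v a, (mI v).mul_mem_left _ (linP_mem v a), ?_⟩
  have : (C ((v a - u a)⁻¹) * linP u a + - C ((v a - u a)⁻¹) * linP v a : RPoly N)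
      = C ((v a - u a)⁻¹ * (v a - u a)) := by
    simp only [linP, C_mul, C_sub]; ring
  rw [this, inv_mul_cancel₀ hne, C_1]

/-- quadratic form at `u` -/
noncomputable def qf (H : Fin N → Fin N → ℝ) (u : Fin N → ℝ) : RPoly N :=
  ∑ a, ∑ b, C (H a b) * (linP u a * linP u b)

lemma qf_mem (H : Fin N → Fin N → ℝ) (u : Fin N → ℝ) : qf H u ∈ mI u ^ 2 := by
  refine Ideal.sum_mem _ fun a _ => Ideal.sum_mem _ fun b _ => Ideal.mul_mem_left _ _ ?_
  rw [pow_two]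
  exact Ideal.mul_mem_mul (linP_mem u a) (linP_mem u b)

lemma eval_qf (H : Fin N → Fin N → ℝ) (u x : Fin N → ℝ) :
    eval x (qf H u) = ∑ a, ∑ b, H a b * ((x a - u a) * (x b - u b)) := by
  simp [qf, eval_linP]

noncomputable def jet1 (p : RPoly N) (u : Fin N → ℝ) : RPoly N := ∑ a, C (gradP p u a) * linP u a

lemma gradP_add (p q : RPoly N) (u : Fin N → ℝ) : gradP (p + q) u = gradP p u + gradP q u := by
  ext i; simp [gradP]

lemma hessP_add (p q : RPoly N) (u : Fin N → ℝ) : hessP (p + q) u = hessP p u + hessP q u := by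
  ext i; simp [hessP]

lemma gradP_mul (p q : RPoly N) (u : Fin N → ℝ) (i : Fin N) :
    gradP (p * q) u i = eval u p * gradP q u i + gradP p u i * eval u q := by
  simp [gradP, Derivation.leibniz]; ring

lemma hessP_mul (p q : RPoly N) (u : Fin N → ℝ) (i j : Fin N) :
    hessP (p * q) u i j = eval u p * hessP q u i j + hessP p u i j * eval u q +
      gradP p u i * gradP q u j + gradP p u j * gradP q u i := by
  simp [hessP, gradP, Derivation.leibniz]; ring

lemma taylor (p : RPoly N) (u : Fin N → ℝ) :
    p - (C (eval u p) + jet1 p u + C (1/2) * qf (hessP p u) u) ∈ mI u ^ 3 := by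
  induction p using MvPolynomial.induction_on with
  | C a => 
    have h1 : gradP (C a) u = 0 := by ext i; simp [gradP]
    have h2 : hessP (C a) u = 0 := by ext i; simp [hessP]
    simp [jet1, qf, h1, h2]
  | add p q hp hq =>
    convert (mI u ^ 3).add_mem hp hq using 1
    simp only [map_add, gradP_add, hessP_add, jet1, qf, Pi.add_apply, add_mul, Finset.sum_add_distrib, mul_add]
    ring
  | mul_X p i hp =>
    have h1 := (mI u ^ 3).mul_mem_right (X i) hp
    have h2 : C (1/2) * (qf (hessP p u) u * linP u i) ∈ mI u ^ 3 := by
      refine Ideal.mul_mem_left _ _ ?_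
      rw [pow_succ]
      exact Ideal.mul_mem_mul (qf_mem _ _) (linP_mem u i)
    convert (mI u ^ 3).add_mem h1 h2 using 1
    have gX : ∀ a, gradP (X i) u a = if a = i then 1 else 0 := by
      intro a
      simp only [gradP, pderiv_X, Pi.single_apply, eq_comm (a := i)]
      split_ifs <;> simp
    have hX : ∀ a b, hessP (X i) u a b = 0 := by
      intro a b
      simp [hessP, pderiv_X, Pi.single_apply]
      split_ifs <;> simp
    have e1 : jet1 (p * X i) u = C (eval u p) * linP u i + C (u i) * jet1 p u := by
      simp only [jet1, gradP_mul, gX, eval_X, C_add, C_mul, add_mul, Finset.sum_add_distrib, Finset.mul_sum]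
      congr 1
      · simp [Finset.sum_ite_eq', apply_ite]
      · refine Finset.sum_congr rfl fun a _ => by ring
    have e2 : qf (hessP (p * X i) u) u = C (u i) * qf (hessP p u) u + 2 * (jet1 p u * linP u i) := by
      simp only [qf, hessP_mul, gX, hX, eval_X, C_add, C_mul, add_mul, Finset.sum_add_distrib, Finset.mul_sum]
      have e3 : ∑ x, ∑ y, C (gradP p u x) * C (if y = i then (1:ℝ) else 0) * (linP u x * linP u y)
         = jet1 p u * linP u i := by
        rw [jet1, Finset.sum_mul]
        refine Finset.sum_congr rfl fun a _ => ?_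
        simp [apply_ite]; ring
      have e4 : ∑ x, ∑ y, C (gradP p u y) * C (if x = i then (1:ℝ) else 0) * (linP u x * linP u y)
         = jet1 p u * linP u i := by
        rw [Finset.sum_comm, ← e3]
        refine Finset.sum_congr rfl fun a _ => Finset.sum_congr rfl fun b _ => by ring
      rw [e3, e4]
      simp only [C_0, mul_zero, zero_mul, Finset.sum_const_zero, zero_add]
      have : ∑ x, ∑ y, C (hessP p u x y) * C (u i) * (linP u x * linP u y) = 
        ∑ x, ∑ y, C (u i) * (C (hessP p u x y) * (linP u x * linP u y)) :=
        Finset.sum_congr rfl fun a _ => Finset.sum_congr rfl fun b _ => by ring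
      rw [this]; ring
    have e5 : (C (1/2) : RPoly N) * 2 = 1 := by
      rw [show (2 : RPoly N) = C 2 from (map_ofNat C 2).symm, ← C_mul]; norm_num
    have e6 : (X i : RPoly N) = linP u i + C (u i) := by simp [linP]
    rw [e1, e2, mul_add, ← mul_assoc (C (1/2)) 2, e5]
    simp only [map_mul, eval_X]
    rw [show p * X i = p * (linP u i + C (u i)) by rw [← e6], e6]
    ring

/-- positive definite second-order jet with vanishing first-order jet -/
def PDjet (u : Fin N → ℝ) (R : RPoly N) : Prop :=
  ∃ H : Fin N → Fin N → ℝ, (∀ a b, H a b = H b a) ∧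
    (∀ v : Fin N → ℝ, v ≠ 0 → 0 < ∑ a, ∑ b, H a b * (v a * v b)) ∧ R - qf H u ∈ mI u ^ 3

lemma PDjet.congr {u : Fin N → ℝ} {R R' : RPoly N} (h : PDjet u R) (h' : R' - R ∈ mI u ^ 3) :
    PDjet u R' := by
  obtain ⟨H, h1, h2, h3⟩ := h
  refine ⟨H, h1, h2, ?_⟩
  convert (mI u ^ 3).add_mem h3 h' using 1; ring

lemma PDjet.mem {u : Fin N → ℝ} {R : RPoly N} (h : PDjet u R) : R ∈ mI u ^ 2 := by
  obtain ⟨H, h1, h2, h3⟩ := h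
  have := (mI u ^ 2).add_mem (Ideal.pow_le_pow_right (by norm_num) h3) (qf_mem H u)
  simpa using this

lemma compact_lemma {α : Type*} [TopologicalSpace α] {X : Set α} (hX : IsCompact X)
    {a b : α → ℝ} (ha : Continuous a) (hb : Continuous b) (hb0 : ∀ x ∈ X, 0 ≤ b x)
    (hab : ∀ x ∈ X, b x = 0 → 0 < a x) : ∃ c : ℝ, 0 ≤ c ∧ ∀ x ∈ X, 0 < a x + c * b x := by
  have hsub : X ⊆ ⋃ k : ℕ, {x | 0 < a x + k * b x} := by
    intro x hx
    rw [Set.mem_iUnion]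
    rcases (hb0 x hx).eq_or_lt with h | h
    · exact ⟨0, by simpa using hab x hx h.symm⟩
    · obtain ⟨k, hk⟩ := exists_nat_gt (-a x / b x)
      refine ⟨k, ?_⟩
      rw [div_lt_iff₀ h] at hk
      simp only [Set.mem_ofPred_eq]; linarith
  obtain ⟨t, ht⟩ := hX.elim_finite_subcover _ 
    (fun k : ℕ => isOpen_lt continuous_const (ha.add (continuous_const.mul hb))) hsub
  refine ⟨((t.sup id : ℕ) : ℝ), Nat.cast_nonneg _, fun x hx => ?_⟩
  have := ht hx
  simp only [Set.mem_iUnion] at this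
  obtain ⟨k, hk, hk'⟩ := this
  have h1 : (k : ℝ) ≤ ((t.sup id : ℕ) : ℝ) := by exact_mod_cast Finset.le_sup (f := id) hk
  have h2 := mul_le_mul_of_nonneg_right h1 (hb0 x hx)
  have hk2 : 0 < a x + k * b x := hk'
  linarith

lemma cont_quad (H : Fin N → Fin N → ℝ) :
    Continuous fun v : Fin N → ℝ => ∑ a, ∑ b, H a b * (v a * v b) := by fun_prop

/-- homogeneous version of the compactness lemma -/
lemma compact_quad {a b : (Fin N → ℝ) → ℝ} (ha : Continuous a) (hb : Continuous b)
    (hb0 : ∀ x, 0 ≤ b x) (hab : ∀ x, x ≠ 0 → b x = 0 → 0 < a x)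
    (ha2 : ∀ (r : ℝ) x, a (r • x) = r ^ 2 * a x) (hb2 : ∀ (r : ℝ) x, b (r • x) = r ^ 2 * b x) :
    ∃ c : ℝ, 0 ≤ c ∧ ∀ x, x ≠ 0 → 0 < a x + c * b x := by
  obtain ⟨c, hc, h⟩ := compact_lemma (isCompact_sphere (0 : Fin N → ℝ) 1) ha hb (fun x _ => hb0 x)
    (fun x hx => hab x (by rintro rfl; simp at hx))
  refine ⟨c, hc, fun x hx => ?_⟩
  have hn : 0 < ‖x‖ := norm_pos_iff.mpr hx
  have := h (‖x‖⁻¹ • x) (by simp [norm_smul, hn.ne'])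
  rw [ha2, hb2] at this
  have h3 : 0 < (‖x‖⁻¹) ^ 2 := by positivity
  have h4 : 0 < (‖x‖⁻¹) ^ 2 * (a x + c * b x) := by linarith
  exact pos_of_mul_pos_right h4 h3.le

lemma quad_smul (H : Fin N → Fin N → ℝ) (r : ℝ) (x : Fin N → ℝ) :
    ∑ a, ∑ b, H a b * ((r • x) a * (r • x) b) = r ^ 2 * ∑ a, ∑ b, H a b * (x a * x b) := by
  simp only [Finset.mul_sum, Pi.smul_apply, smul_eq_mul]
  refine Finset.sum_congr rfl fun a _ => Finset.sum_congr rfl fun b _ => by ring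

lemma bigO_mI {u : Fin N → ℝ} : ∀ (k : ℕ) {p : RPoly N}, p ∈ mI u ^ k →
    (fun x => eval x p) =O[nhds u] fun x => ‖x - u‖ ^ k := by
  intro k
  induction k with
  | zero =>
    intro p _
    simp only [pow_zero]
    exact (p.continuous_eval.tendsto u).isBigO_one ℝ
  | succ k ih =>
    intro p hp
    rw [pow_succ] at hp
    refine Submodule.mul_induction_on hp ?_ ?_
    · intro m hm q hq
      have h1 := ih hm
      have h2 : (fun x => eval x q) =O[nhds u] fun x => ‖x - u‖ := by
        refine Submodule.span_induction ?_ ?_ ?_ ?_ hq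
        · rintro _ ⟨a, rfl⟩
          refine Asymptotics.IsBigO.of_bound 1 (Filter.Eventually.of_forall fun x => ?_)
          simp only [eval_linP, norm_norm, one_mul]
          exact norm_le_pi_norm (x - u) a
        · simpa using Asymptotics.isBigO_zero _ _
        · intro x y _ _ hx hy
          simpa using hx.add hy
        · intro a x _ hx
          have := ((a.continuous_eval.tendsto u).isBigO_one ℝ).mul hx
          simpa using this
      simpa [pow_succ] using h1.mul h2
    · intro x y hx hy
      simpa using hx.add hy

lemma PDjet.local_pos {u : Fin N → ℝ} {R : RPoly N} (h : PDjet u R) :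
    ∀ᶠ x in nhds u, x ≠ u → 0 < eval x R := by
  obtain ⟨H, h1, h2, h3⟩ := h
  -- lower bound
  obtain ⟨c, hc, hcH⟩ : ∃ c : ℝ, 0 ≤ c ∧ ∀ x : Fin N → ℝ, x ≠ 0 →
      0 < -‖x‖ ^ 2 + c * ∑ a, ∑ b, H a b * (x a * x b) := by
    refine compact_quad (a := fun x => -‖x‖^2) (by fun_prop) (cont_quad H) ?_ ?_ ?_ (quad_smul H)
    · intro x
      by_cases hx : x = 0
      · simp [hx]
      · exact (h2 x hx).le
    · intro x hx h0
      exact absurd h0 (h2 x hx).ne'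
    · intro r x
      simp only [norm_smul, mul_pow, Real.norm_eq_abs, sq_abs]; ring
  have hO := bigO_mI 3 h3
  have hlo : (fun x => eval x (R - qf H u)) =o[nhds u] fun x => ‖x - u‖ ^ 2 := by
    refine hO.trans_isLittleO ?_
    have : Filter.Tendsto (fun x : Fin N → ℝ => ‖x - u‖) (nhds u) (nhds 0) := by
      have : Continuous fun x : Fin N → ℝ => ‖x - u‖ := by fun_prop
      simpa using this.tendsto u
    have h5 := (Asymptotics.isLittleO_one_iff ℝ).mpr this
    have := h5.mul_isBigO (Asymptotics.isBigO_refl (fun x : Fin N → ℝ => ‖x - u‖ ^ 2) (nhds u))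
    simpa [pow_succ, mul_comm, mul_assoc] using this
  have := hlo.def (c := 1 / (c + 1)) (by positivity)
  filter_upwards [this] with x hx hxu
  have h6 := hcH (x - u) (sub_ne_zero.mpr hxu)
  have h7 : eval x R = eval x (R - qf H u) + ∑ a, ∑ b, H a b * ((x - u) a * (x - u) b) := by
    rw [map_sub, eval_qf]; simp
  rw [h7]
  set q := ∑ a, ∑ b, H a b * ((x - u) a * (x - u) b)
  rw [Real.norm_eq_abs, Real.norm_of_nonneg (by positivity)] at hx
  have h8 := (abs_le.mp hx).1
  have h9 : 0 < ‖x - u‖ ^ 2 := by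
    have := norm_pos_iff.mpr (sub_ne_zero.mpr hxu); positivity
  have hq : 0 < q := by
    by_contra hq
    have := mul_nonneg hc (by linarith : (0:ℝ) ≤ -q)
    linarith
  have : 1 / (c + 1) * ‖x - u‖ ^ 2 < q := by
    rw [div_mul_eq_mul_div, one_mul, div_lt_iff₀ (by positivity)]
    linarith
  linarith

end PartA

section PartB

lemma exists_state {V : Type*} [AddCommGroup V] [Module ℝ V] (Cn : Set V) 
    (hadd : ∀ x ∈ Cn, ∀ y ∈ Cn, x + y ∈ Cn) (hsm : ∀ (r : ℝ), 0 ≤ r → ∀ x ∈ Cn, r • x ∈ Cn)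
    (Q : V) (hQ : Q ∈ Cn) (hou : ∀ b : V, ∃ c : ℝ, 0 ≤ c ∧ c • Q - b ∈ Cn) (R : V) (hR : R ∉ Cn) :
    ∃ φ : V →ₗ[ℝ] ℝ, (∀ b ∈ Cn, 0 ≤ φ b) ∧ φ Q = 1 ∧ φ R ≤ 0 := by
  have h0 : (0 : V) ∈ Cn := by simpa using hsm 0 le_rfl Q hQ
  have hnQ : -Q ∉ Cn := by
    intro h
    obtain ⟨c, hc, hcb⟩ := hou (-R)
    have := hadd _ hcb _ (hsm c hc _ h)
    exact hR (by simpa using this)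
  have hQ0 : Q ≠ 0 := by
    rintro rfl
    exact hnQ (by simpa using h0)
  let s : PointedCone ℝ V :=
    { carrier := {x | ∃ b ∈ Cn, ∃ r : ℝ, 0 ≤ r ∧ x = b - r • R}
      smul_mem' := by
        rintro ⟨c, hc⟩ x ⟨b, hb, r, hr, rfl⟩
        exact ⟨c • b, hsm c hc b hb, c * r, by positivity, by
          rw [mul_smul, ← smul_sub]; rfl⟩
      zero_mem' := ⟨0, h0, 0, le_rfl, by simp⟩
      add_mem' := by
        rintro x y ⟨b, hb, r, hr, rfl⟩ ⟨b', hb', r', hr', rfl⟩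
        exact ⟨b + b', hadd _ hb _ hb', r + r', by positivity, by rw [add_smul]; abel⟩ }
  have hs : ∀ x, x ∈ s ↔ ∃ b ∈ Cn, ∃ r : ℝ, 0 ≤ r ∧ x = b - r • R := fun x => Iff.rfl
  have k1 : ∀ x : (LinearPMap.mkSpanSingleton (σ := RingHom.id ℝ) Q (1 : ℝ) hQ0).domain, (x : V) ∈ s →
      0 ≤ (LinearPMap.mkSpanSingleton (σ := RingHom.id ℝ) Q (1 : ℝ) hQ0) x := by
    rintro ⟨x, hx⟩ hxs
    obtain ⟨r, rfl⟩ := Submodule.mem_span_singleton.mp hx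
    have e : (LinearPMap.mkSpanSingleton (σ := RingHom.id ℝ) Q (1 : ℝ) hQ0) ⟨r • Q, hx⟩ = r := by
      rw [LinearPMap.mkSpanSingleton'_apply]; simp
    rw [e]
    by_contra hr
    push Not at hr
    obtain ⟨b, hb, t, ht, h⟩ := hxs
    have h1 : t • R = b + (-r) • Q := by
      have : r • Q = b - t • R := h
      rw [neg_smul, this]; abel
    have h2 : t • R ∈ Cn := by rw [h1]; exact hadd _ hb _ (hsm _ (by linarith) _ hQ)
    rcases ht.eq_or_lt with h3 | h3
    · subst h3
      have h4 : b = r • Q := by simpa using h.symm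
      have := hsm (-r)⁻¹ (by rw [inv_nonneg]; linarith) b hb
      rw [h4, smul_smul] at this
      apply hnQ
      have e : (-r)⁻¹ * r = -1 := by rw [inv_neg, neg_mul, inv_mul_cancel₀ hr.ne]
      rwa [e, neg_one_smul] at this
    · have := hsm t⁻¹ (by positivity) _ h2
      rw [smul_smul, inv_mul_cancel₀ h3.ne', one_smul] at this
      exact hR this
  have k2 : ∀ y, ∃ x : (LinearPMap.mkSpanSingleton (σ := RingHom.id ℝ) Q (1 : ℝ) hQ0).domain,
      (x : V) + y ∈ s := by
    intro y
    obtain ⟨c, hc, hcb⟩ := hou (-y)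
    refine ⟨⟨c • Q, Submodule.mem_span_singleton.mpr ⟨c, rfl⟩⟩, ?_⟩
    exact (hs _).2 ⟨_, hcb, 0, le_rfl, by simp⟩
  obtain ⟨g, hg1, hg2⟩ := riesz_extension s (LinearPMap.mkSpanSingleton (σ := RingHom.id ℝ) Q (1 : ℝ) hQ0) k1 k2
  refine ⟨g, fun b hb => hg2 b ((hs b).2 ⟨b, hb, 0, le_rfl, by simp⟩), ?_, ?_⟩
  · have := hg1 ⟨Q, Submodule.mem_span_singleton_self Q⟩
    exact this.trans (LinearPMap.mkSpanSingleton_apply (σ := RingHom.id ℝ) ℝ ℝ hQ0 (1 : ℝ))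
  · have := hg2 (-R) ((hs _).2 ⟨0, h0, 1, by norm_num, by simp⟩)
    simpa using this

lemma exists_extreme_state {V : Type*} [AddCommGroup V] [Module ℝ V] (Cn : Set V) 
    (hadd : ∀ x ∈ Cn, ∀ y ∈ Cn, x + y ∈ Cn) (hsm : ∀ (r : ℝ), 0 ≤ r → ∀ x ∈ Cn, r • x ∈ Cn)
    (Q : V) (hQ : Q ∈ Cn) (hou : ∀ b : V, ∃ c : ℝ, 0 ≤ c ∧ c • Q - b ∈ Cn) (R : V)
    (hR : ∀ ε : ℝ, 0 < ε → R - ε • Q ∉ Cn) :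
    ∃ φ : V →ₗ[ℝ] ℝ, (∀ b ∈ Cn, 0 ≤ φ b) ∧ φ Q = 1 ∧ φ R ≤ 0 ∧
      ∀ ψ : V →ₗ[ℝ] ℝ, (∀ b ∈ Cn, 0 ≤ ψ b) → (∀ b ∈ Cn, ψ b ≤ φ b) → ∀ b, ψ b = ψ Q * φ b := by
  choose c hc0 hc using hou
  let St : Set (V → ℝ) := {f | (∀ x y, f (x + y) = f x + f y) ∧ (∀ (r : ℝ) x, f (r • x) = r * f x) ∧
    (∀ b ∈ Cn, 0 ≤ f b) ∧ f Q = 1}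
  have hclosed : IsClosed St := by
    have e : St = (⋂ x, ⋂ y, {f : V → ℝ | f (x + y) = f x + f y}) ∩
      ((⋂ r : ℝ, ⋂ x, {f : V → ℝ | f (r • x) = r * f x}) ∩ ((⋂ b ∈ Cn, {f : V → ℝ | 0 ≤ f b}) ∩
        {f : V → ℝ | f Q = 1})) := by
      ext f; simp [St]
    rw [e]
    refine IsClosed.inter ?_ (IsClosed.inter ?_ (IsClosed.inter ?_ ?_))
    · exact isClosed_iInter fun x => isClosed_iInter fun y =>
        isClosed_eq (by fun_prop) (by fun_prop)
    · exact isClosed_iInter fun x => isClosed_iInter fun y =>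
        isClosed_eq (by fun_prop) (by fun_prop)
    · exact isClosed_iInter fun x => isClosed_iInter fun y =>
        isClosed_le (by fun_prop) (by fun_prop)
    · exact isClosed_eq (by fun_prop) (by fun_prop)
  have lin : ∀ f ∈ St, ∃ g : V →ₗ[ℝ] ℝ, ⇑g = f := fun f hf =>
    ⟨{ toFun := f, map_add' := hf.1, map_smul' := hf.2.1 }, rfl⟩
  have hle : ∀ f ∈ St, ∀ b, f b ≤ c b := by
    intro f hf b
    obtain ⟨g, rfl⟩ := lin f hf
    have := hf.2.2.1 _ (hc b)
    have h2 := hf.2.2.2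
    simp [h2] at this
    linarith
  have hcomp : IsCompact St := by
    refine IsCompact.of_isClosed_subset
      (isCompact_univ_pi (fun b : V => isCompact_Icc (a := -c (-b)) (b := c b))) hclosed ?_
    intro f hf b _
    refine ⟨?_, hle f hf b⟩
    have := hle f hf (-b)
    obtain ⟨g, rfl⟩ := lin f hf
    rw [map_neg] at this
    linarith
  have hex : ∀ ε : ℝ, 0 < ε → ∃ f ∈ St, f R ≤ ε := by
    intro ε hε
    obtain ⟨φ, h1, h2, h3⟩ := exists_state Cn hadd hsm Q hQ (fun b => ⟨c b, hc0 b, hc b⟩) _ (hR ε hε)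
    refine ⟨φ, ⟨map_add φ, fun r x => by simp, h1, h2⟩, ?_⟩
    simp [h2] at h3
    linarith
  obtain ⟨f0, hf0, hmin⟩ := hcomp.exists_isMinOn (f := fun f : V → ℝ => f R)
    (let ⟨f, hf, _⟩ := hex 1 one_pos; ⟨f, hf⟩) (by fun_prop)
  have hf0R : f0 R ≤ 0 := by
    refine le_of_forall_pos_le_add fun ε hε => ?_
    obtain ⟨f, hf, h⟩ := hex ε hε
    have : f0 R ≤ f R := hmin hf
    linarith
  let Fa : Set (V → ℝ) := St ∩ {f | f R = f0 R}
  have hFa : IsCompact Fa := hcomp.inter_right (isClosed_eq (by fun_prop) (by fun_prop))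
  obtain ⟨f1, hf1⟩ := hFa.extremePoints_nonempty ⟨f0, hf0, rfl⟩
  rw [mem_extremePoints] at hf1
  obtain ⟨⟨hf1S, hf1R⟩, hext⟩ := hf1
  obtain ⟨φ, rfl⟩ := lin f1 hf1S
  have hf1R' : φ R = f0 R := hf1R
  have hφQ : φ Q = 1 := hf1S.2.2.2
  refine ⟨φ, hf1S.2.2.1, hφQ, by rw [hf1R']; exact hf0R, ?_⟩
  intro ψ hψ hψφ b
  have zero_of : ∀ θ : V →ₗ[ℝ] ℝ, (∀ b ∈ Cn, 0 ≤ θ b) → θ Q = 0 → ∀ b, θ b = 0 := by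
    intro θ hθ hθQ b
    have h1 := hθ _ (hc b)
    have h2 := hθ _ (hc (-b))
    simp [hθQ] at h1 h2
    linarith
  have hs0 := hψ Q hQ
  have hs1 := hψφ Q hQ
  rw [hφQ] at hs1
  rcases hs0.eq_or_lt with h | h
  · rw [zero_of ψ hψ h.symm b, ← h, zero_mul]
  rcases hs1.eq_or_lt with h' | h'
  · have := zero_of (φ - ψ) (fun b hb => by simpa using hψφ b hb) (by simp [hφQ, h']) b
    simp at this
    rw [h', one_mul]; linarith
  set s := ψ Q with hs
  have hA : ((s⁻¹ • ψ : V →ₗ[ℝ] ℝ) : V → ℝ) ∈ St :=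
    ⟨map_add _, fun r x => by rw [map_smul, smul_eq_mul], fun b hb => by
      have := hψ b hb
      simp only [LinearMap.smul_apply, smul_eq_mul]; positivity, by
      simp [← hs, h.ne']⟩
  have hB : (((1 - s)⁻¹ • (φ - ψ) : V →ₗ[ℝ] ℝ) : V → ℝ) ∈ St :=
    ⟨map_add _, fun r x => by rw [map_smul, smul_eq_mul], fun b hb => by
      have := hψφ b hb
      simp only [LinearMap.smul_apply, smul_eq_mul, LinearMap.sub_apply]
      exact mul_nonneg (inv_nonneg.mpr (by linarith)) (by linarith), by
      have : 1 - s ≠ 0 := by linarith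
      simp [← hs, hφQ, this]⟩
  have hAR : f0 R ≤ s⁻¹ * ψ R := hmin hA
  have hBR : f0 R ≤ (1 - s)⁻¹ * (φ R - ψ R) := hmin hB
  have hs' : 0 < 1 - s := by linarith
  have eA : s⁻¹ * ψ R = f0 R := by
    refine le_antisymm ?_ hAR
    rw [inv_mul_eq_div, le_div_iff₀ hs'] at hBR
    rw [inv_mul_eq_div, div_le_iff₀ h]
    rw [hf1R'] at hBR
    linarith
  have eB : (1 - s)⁻¹ * (φ R - ψ R) = f0 R := by
    rw [inv_mul_eq_div, div_eq_iff h.ne'] at eA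
    rw [inv_mul_eq_div, div_eq_iff hs'.ne', hf1R', eA]; ring
  have := (hext _ ⟨hA, eA⟩ _ ⟨hB, eB⟩ ⟨s, 1 - s, h, hs', by ring, ?_⟩)
  · have h9 := congrFun this.1 b
    simp only [LinearMap.smul_apply, smul_eq_mul] at h9
    rw [← h9, mul_inv_cancel_left₀ h.ne']
  · ext b
    simp only [Pi.add_apply, Pi.smul_apply, LinearMap.smul_apply, smul_eq_mul, LinearMap.sub_apply]
    rw [mul_inv_cancel_left₀ h.ne', mul_inv_cancel_left₀ hs'.ne']; ring

end PartB

section PartC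
variable {N : ℕ}

structure GoodM (M : AddSubmonoid (RPoly N)) : Prop where
  one : (1 : RPoly N) ∈ M
  sq : ∀ q m : RPoly N, m ∈ M → q ^ 2 * m ∈ M
  sph : ∀ q : RPoly N, ((∑ i, (X i : RPoly N) ^ 2) - 1) * q ∈ M

variable {M : AddSubmonoid (RPoly N)}

lemma GoodM.sq' (hM : GoodM M) (q : RPoly N) : q ^ 2 ∈ M := by
  simpa using hM.sq q 1 hM.one

lemma GoodM.smul (hM : GoodM M) {r : ℝ} (hr : 0 ≤ r) {m : RPoly N} (hm : m ∈ M) : C r * m ∈ M := by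
  have := hM.sq (C (Real.sqrt r)) m hm
  rwa [← C_pow, Real.sq_sqrt hr] at this

lemma GoodM.half (hM : GoodM M) {m : RPoly N} (hm : 2 * m ∈ M) : m ∈ M := by
  have := hM.smul (r := 1/2) (by norm_num) hm
  rw [← mul_assoc, show (2 : RPoly N) = C 2 from (map_ofNat C 2).symm, ← C_mul] at this
  norm_num at this
  exact this

lemma GoodM.one_sub (hM : GoodM M) (i : Fin N) {m : RPoly N} (hm : m ∈ M) (s : ℝ) (hs : s ^ 2 = 1) :
    (1 - C s * X i) * m ∈ M := by
  apply hM.half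
  have h1 := hM.sq (1 - C s * X i) m hm
  have h2 : ∑ j ∈ Finset.univ.erase i, (X j : RPoly N) ^ 2 * m ∈ M :=
    AddSubmonoid.sum_mem _ fun j _ => hM.sq _ _ hm
  have h3 := hM.sph (-m)
  convert M.add_mem (M.add_mem h1 h2) h3 using 1
  rw [← Finset.add_sum_erase _ _ (Finset.mem_univ i), ← Finset.sum_mul]
  have : (C s : RPoly N) ^ 2 = 1 := by rw [← C_pow, hs, C_1]
  linear_combination (-(X i : RPoly N) ^ 2 * m) * this

lemma GoodM.bdd (hM : GoodM M) (a : RPoly N) :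
    ∃ B : ℝ, 0 ≤ B ∧ ∀ m ∈ M, (C B + a) * m ∈ M ∧ (C B - a) * m ∈ M := by
  induction a using MvPolynomial.induction_on with
  | C r =>
    refine ⟨|r|, abs_nonneg r, fun m hm => ?_⟩
    rw [← C_add, ← C_sub]
    exact ⟨hM.smul (by linarith [neg_abs_le r]) hm, hM.smul (by linarith [le_abs_self r]) hm⟩
  | add p q hp hq =>
    obtain ⟨B, hB, h⟩ := hp
    obtain ⟨B', hB', h'⟩ := hq
    refine ⟨B + B', by positivity, fun m hm => ⟨?_, ?_⟩⟩
    · convert M.add_mem (h m hm).1 (h' m hm).1 using 1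
      rw [C_add]; ring
    · convert M.add_mem (h m hm).2 (h' m hm).2 using 1
      rw [C_add]; ring
  | mul_X p i hp =>
    obtain ⟨B, hB, h⟩ := hp
    refine ⟨B, hB, fun m hm => ?_⟩
    have p1 := hM.one_sub i (h m hm).1 1 (by norm_num)
    have p2 := hM.one_sub i (h m hm).2 1 (by norm_num)
    have p3 := hM.one_sub i (h m hm).1 (-1) (by norm_num)
    have p4 := hM.one_sub i (h m hm).2 (-1) (by norm_num)
    constructor <;> apply hM.half
    · convert M.add_mem p3 p2 using 1
      simp only [C_neg, C_1]; ring
    · convert M.add_mem p1 p4 using 1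
      simp only [C_neg, C_1]; ring

lemma GoodM.order_unit (hM : GoodM M) (t : Finset (RPoly N)) (b : RPoly N)
    (hb : b ∈ (Ideal.span (t : Set (RPoly N))) ^ 2) :
    ∃ c : ℝ, 0 ≤ c ∧ C c * (∑ s ∈ t, s ^ 2) - b ∈ M ∧ C c * (∑ s ∈ t, s ^ 2) + b ∈ M := by
  rw [pow_two, Ideal.span_mul_span'] at hb
  have hsub : ∀ x ∈ t, (∑ s ∈ t, s ^ 2) - x ^ 2 ∈ M := by
    classical
    intro x hx
    rw [← Finset.add_sum_erase _ _ hx, add_sub_cancel_left]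
    exact AddSubmonoid.sum_mem _ fun j _ => hM.sq' _
  refine Submodule.span_induction ?_ ?_ ?_ ?_ hb
  · rintro _ ⟨x, hx, y, hy, rfl⟩
    refine ⟨1, by norm_num, ?_, ?_⟩ <;> apply hM.half
    · convert M.add_mem (M.add_mem (hsub x hx) (hsub y hy)) (hM.sq' (x - y)) using 1
      simp only [C_1]; ring
    · convert M.add_mem (M.add_mem (hsub x hx) (hsub y hy)) (hM.sq' (x + y)) using 1
      simp only [C_1]; ring
  · exact ⟨0, le_rfl, by simp, by simp⟩
  · rintro x y _ _ ⟨c, hc, h1, h2⟩ ⟨c', hc', h1', h2'⟩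
    refine ⟨c + c', by positivity, ?_, ?_⟩
    · convert M.add_mem h1 h1' using 1
      rw [C_add]; ring
    · convert M.add_mem h2 h2' using 1
      rw [C_add]; ring
  · rintro a x _ ⟨c, hc, h1, h2⟩
    obtain ⟨B, hB, h⟩ := hM.bdd a
    refine ⟨B * c, by positivity, ?_, ?_⟩ <;> apply hM.half
    · convert M.add_mem (h _ h1).1 (h _ h2).2 using 1
      rw [C_mul, smul_eq_mul]; ring
    · convert M.add_mem (h _ h2).1 (h _ h1).2 using 1
      rw [C_mul, smul_eq_mul]; ring

/-- the pure state theorem -/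
lemma GoodM.pure (hM : GoodM M) (J : Ideal (RPoly N)) (Q R : RPoly N) (hQJ : Q ∈ J) (hRJ : R ∈ J)
    (hQ : Q ∈ M) (hou : ∀ b ∈ J, ∃ c : ℝ, 0 ≤ c ∧ C c * Q - b ∈ M)
    (hR : ∀ ε : ℝ, 0 < ε → R - C ε * Q ∉ M) :
    ∃ (φ : J →ₗ[ℝ] ℝ) (x : Fin N → ℝ), (∀ b : J, (b : RPoly N) ∈ M → 0 ≤ φ b) ∧
      φ ⟨Q, hQJ⟩ = 1 ∧ φ ⟨R, hRJ⟩ ≤ 0 ∧ ∀ (a : RPoly N) (b : J), φ (a • b) = eval x a * φ b := by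
  have hsmul : ∀ (r : ℝ) (b : J), ((r • b : J) : RPoly N) = C r * (b : RPoly N) := by
    intro r b
    rw [← MvPolynomial.smul_eq_C_mul]; rfl
  obtain ⟨φ, h1, h2, h3, h4⟩ := exists_extreme_state {b : J | (b : RPoly N) ∈ M}
    (fun x hx y hy => M.add_mem hx hy)
    (fun r hr x hx => by
      have := hM.smul hr hx
      simpa [MvPolynomial.smul_eq_C_mul] using this) ⟨Q, hQJ⟩ hQ
    (fun b => by
      obtain ⟨c, hc, h⟩ := hou b b.2
      refine ⟨c, hc, ?_⟩
      simpa [MvPolynomial.smul_eq_C_mul] using h) ⟨R, hRJ⟩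
    (fun ε hε h => hR ε hε (by simpa [MvPolynomial.smul_eq_C_mul] using h))
  refine ⟨φ, fun i => φ ((X i : RPoly N) • ⟨Q, hQJ⟩), h1, h2, h3, ?_⟩
  have hX : ∀ (i : Fin N) (b : J), φ ((X i : RPoly N) • b) = φ ((X i : RPoly N) • ⟨Q, hQJ⟩) * φ b := by
    intro i b
    let ψ : J →ₗ[ℝ] ℝ := (1/2 : ℝ) • (φ + 
      { toFun := fun b => φ ((X i : RPoly N) • b)
        map_add' := fun x y => by rw [smul_add, map_add]
        map_smul' := fun r x => by
          rw [smul_comm, map_smul]; rfl })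
    have hψ : ∀ b, ψ b = 1/2 * (φ b + φ ((X i : RPoly N) • b)) := fun b => rfl
    have := h4 ψ ?_ ?_ b
    · rw [hψ, hψ, h2] at this
      linarith
    · intro b hb
      have : 0 ≤ φ ((1 - C (-1) * X i : RPoly N) • b) := h1 _ (hM.one_sub i hb (-1) (by norm_num))
      simp only [C_neg, C_1, neg_mul, one_mul, sub_neg_eq_add, add_smul, one_smul, map_add] at this
      rw [hψ]; linarith
    · intro b hb
      have : 0 ≤ φ ((1 - C 1 * X i : RPoly N) • b) := h1 _ (hM.one_sub i hb 1 (by norm_num))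
      have e : (1 - C 1 * X i : RPoly N) • b = b - (X i : RPoly N) • b :=
        Subtype.ext (by simp [sub_mul])
      rw [e, map_sub] at this
      rw [hψ]; linarith
  intro a
  induction a using MvPolynomial.induction_on with
  | C r =>
    intro b
    have : (C r : RPoly N) • b = r • b := Subtype.ext (by rw [hsmul]; rfl)
    rw [this, map_smul, eval_C, smul_eq_mul]
  | add p q hp hq => intro b; rw [add_smul, map_add, hp, hq, map_add, add_mul]
  | mul_X p i hp => intro b; rw [mul_smul, hp, hX, map_mul, eval_X, mul_assoc]

end PartC

section PartD
variable {N : ℕ}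

lemma qf_add (H H' : Fin N → Fin N → ℝ) (u : Fin N → ℝ) :
    qf (fun a b => H a b + H' a b) u = qf H u + qf H' u := by
  simp only [qf, C_add, add_mul, Finset.sum_add_distrib]

lemma qf_smul (r : ℝ) (H : Fin N → Fin N → ℝ) (u : Fin N → ℝ) :
    qf (fun a b => r * H a b) u = C r * qf H u := by
  simp only [qf, C_mul, Finset.mul_sum, mul_assoc]

lemma qf_swap (H : Fin N → Fin N → ℝ) (u : Fin N → ℝ) :
    qf (fun a b => H b a) u = qf H u := by
  rw [qf, Finset.sum_comm]
  exact Finset.sum_congr rfl fun a _ => Finset.sum_congr rfl fun b _ => by ring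

lemma qf_sum {ι : Type*} (s : Finset ι) (H : ι → Fin N → Fin N → ℝ) (u : Fin N → ℝ) :
    qf (fun a b => ∑ j ∈ s, H j a b) u = ∑ j ∈ s, qf (H j) u := by
  classical
  induction s using Finset.induction_on with
  | empty => simp [qf]
  | insert j s hj ih => simp only [Finset.sum_insert hj, qf_add, ih]

lemma qf_rank1 (p : RPoly N) (u : Fin N → ℝ) :
    qf (fun a b => gradP p u a * gradP p u b) u = jet1 p u ^ 2 := by
  rw [jet1, pow_two, Finset.sum_mul_sum, qf]
  refine Finset.sum_congr rfl fun a _ => Finset.sum_congr rfl fun b _ => ?_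
  rw [C_mul]; ring

lemma jet1_mem (p : RPoly N) (u : Fin N → ℝ) : jet1 p u ∈ mI u :=
  Ideal.sum_mem _ fun a _ => Ideal.mul_mem_left _ _ (linP_mem u a)

lemma eval_jet1 (p : RPoly N) (u v : Fin N → ℝ) :
    eval (u + v) (jet1 p u) = ∑ a, v a * gradP p u a := by
  simp [jet1, eval_linP, mul_comm]

lemma eval_qf' (H : Fin N → Fin N → ℝ) (u v : Fin N → ℝ) :
    eval (u + v) (qf H u) = ∑ a, ∑ b, H a b * (v a * v b) := by
  simp [eval_qf]

lemma sq_jet (p : RPoly N) (u : Fin N → ℝ) (hp : eval u p = 0) :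
    p ^ 2 - jet1 p u ^ 2 ∈ mI u ^ 3 := by
  have h1 := taylor p u
  have h2 : p - jet1 p u ∈ mI u ^ 2 := by
    have h3 := (mI u ^ 2).add_mem (Ideal.pow_le_pow_right (by norm_num) h1)
      ((mI u ^ 2).mul_mem_left (C (1/2)) (qf_mem (hessP p u) u))
    rw [hp, C_0] at h3
    convert h3 using 1; ring
  have h4 : p + jet1 p u ∈ mI u := (mI u).add_mem (mem_mI.2 hp) (jet1_mem p u)
  rw [pow_succ]
  convert Ideal.mul_mem_mul h2 h4 using 1; ring

set_option maxHeartbeats 2000000 in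
lemma local_cert {ι κ : Type} (Es : Finset ι) (h : ι → RPoly N) (Is : Finset κ) (g : κ → RPoly N)
    (F : RPoly N) (u : Fin N → ℝ) (hE : ∀ j ∈ Es, eval u (h j) = 0)
    (hF : eval u F = 0) (hopt : OptCondsAt Es h Is g F u) :
    ∃ (p : ι → RPoly N) (q : κ → RPoly N),
      PDjet u (F - ∑ j ∈ Es, h j * p j - ∑ j ∈ Is, g j * q j ^ 2) := by
  classical
  obtain ⟨-, lE, lI, hK, hl, hscc, hsosc⟩ := hopt
  set Ia := Is.filter (fun j => eval u (g j) = 0) with hIa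
  set L2 : Fin N → Fin N → ℝ := fun a b => 
    hessP F u a b - ∑ j ∈ Es, lE j * hessP (h j) u a b - ∑ j ∈ Is, lI j * hessP (g j) u a b with hL2
  set G : RPoly N := F - ∑ j ∈ Es, C (lE j) * h j - ∑ j ∈ Is, C (lI j) * g j with hG
  have G0 : eval u G = 0 := by
    simp only [hG, map_sub, map_sum, map_mul, eval_C, hF]
    rw [Finset.sum_eq_zero fun j hj => by rw [hE j hj, mul_zero],
      Finset.sum_eq_zero fun j hj => (hl j hj).2]
    simp
  have G1 : gradP G u = 0 := by
    ext a
    have := congrFun hK a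
    simp only [gradP, Pi.add_apply, Finset.sum_apply, Pi.smul_apply, smul_eq_mul] at this
    simp [gradP, hG, this, Derivation.leibniz]
  have G2 : hessP G u = L2 := by
    ext a b
    simp [hessP, hG, hL2, Derivation.leibniz]
  have GT : G - C (1/2) * qf L2 u ∈ mI u ^ 3 := by
    have := taylor G u
    rw [G0, G2] at this
    simpa [jet1, G1] using this
  -- the constant
  obtain ⟨c, hc, hcpos⟩ : ∃ c : ℝ, 0 ≤ c ∧ ∀ v : Fin N → ℝ, v ≠ 0 → 
      0 < (1/2) * (∑ a, ∑ b, L2 a b * (v a * v b)) + c * (∑ j ∈ Es, (∑ a, v a * gradP (h j) u a) ^ 2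
        + ∑ j ∈ Ia, (∑ a, v a * gradP (g j) u a) ^ 2) := by
    refine compact_quad (a := fun v => (1/2) * (∑ a, ∑ b, L2 a b * (v a * v b)))
      (b := fun v => ∑ j ∈ Es, (∑ a, v a * gradP (h j) u a) ^ 2
        + ∑ j ∈ Ia, (∑ a, v a * gradP (g j) u a) ^ 2) ?_ ?_ ?_ ?_ ?_ ?_
    · exact continuous_const.mul (cont_quad L2)
    · fun_prop
    · intro x; positivity
    · intro v hv h0
      have n1 : 0 ≤ ∑ j ∈ Es, (∑ a, v a * gradP (h j) u a) ^ 2 := by positivity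
      have n2 : 0 ≤ ∑ j ∈ Ia, (∑ a, v a * gradP (g j) u a) ^ 2 := by positivity
      have z1 := (Finset.sum_eq_zero_iff_of_nonneg (fun j _ => by positivity)).1 
        (by linarith : ∑ j ∈ Es, (∑ a, v a * gradP (h j) u a) ^ 2 = 0)
      have z2 := (Finset.sum_eq_zero_iff_of_nonneg (fun j _ => by positivity)).1 
        (by linarith : ∑ j ∈ Ia, (∑ a, v a * gradP (g j) u a) ^ 2 = 0)
      have := hsosc v hv (fun j hj => by simpa using z1 j hj)
        (fun j hj hj0 => by simpa using z2 j (Finset.mem_filter.2 ⟨hj, hj0⟩))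
      have e : ∑ a, ∑ b, L2 a b * (v a * v b) = ∑ i, ∑ i', v i *
        ((hessP F u i i' - ∑ j ∈ Es, lE j * hessP (h j) u i i')
          - ∑ j ∈ Is, lI j * hessP (g j) u i i') * v i' :=
        Finset.sum_congr rfl fun a _ => Finset.sum_congr rfl fun b _ => by simp only [hL2]; ring
      rw [e]; linarith
    · intro r x; rw [quad_smul]; ring
    · intro r x
      have : ∀ p : RPoly N, (∑ a, (r • x) a * gradP p u a) ^ 2 = r ^ 2 * (∑ a, x a * gradP p u a) ^ 2 := by
        intro p
        rw [← mul_pow, Finset.mul_sum]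
        simp only [Pi.smul_apply, smul_eq_mul, mul_assoc]
      simp only [this, mul_add, Finset.mul_sum]
  set H : Fin N → Fin N → ℝ := fun a b => 1/4 * (L2 a b + L2 b a) + 
    c * (∑ j ∈ Es, gradP (h j) u a * gradP (h j) u b + ∑ j ∈ Ia, gradP (g j) u a * gradP (g j) u b) with hH
  have hqH : qf H u = C (1/2) * qf L2 u + C c * (∑ j ∈ Es, jet1 (h j) u ^ 2 + ∑ j ∈ Ia, jet1 (g j) u ^ 2) := by
    rw [hH, qf_add, qf_smul, qf_smul, qf_add, qf_add, qf_sum, qf_sum, qf_swap]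
    simp only [qf_rank1]
    congr 1
    rw [← two_mul, ← mul_assoc, show (2 : RPoly N) = C 2 from (map_ofNat C 2).symm, ← C_mul]
    norm_num
  refine ⟨fun j => C (lE j) - C c * h j, 
    fun j => C (Real.sqrt (lI j)) - C (c / (2 * Real.sqrt (lI j))) * g j, H, ?_, ?_, ?_⟩
  · intro a b
    simp only [hH]
    congr 1
    · ring
    · congr 2 <;> exact Finset.sum_congr rfl fun j _ => by ring
  · intro v hv
    rw [← eval_qf' H u v, hqH]
    simp only [map_add, map_mul, eval_C, map_sum, map_pow, eval_qf', eval_jet1]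
    exact hcpos v hv
  · have m1 : C c * (∑ j ∈ Es, (h j ^ 2 - jet1 (h j) u ^ 2)) ∈ mI u ^ 3 :=
      Ideal.mul_mem_left _ _ (Ideal.sum_mem _ fun j hj => sq_jet _ _ (hE j hj))
    have m2 : C c * (∑ j ∈ Ia, (g j ^ 2 - jet1 (g j) u ^ 2)) ∈ mI u ^ 3 :=
      Ideal.mul_mem_left _ _ (Ideal.sum_mem _ fun j hj => sq_jet _ _ (Finset.mem_filter.1 hj).2)
    have m3 : ∑ j ∈ Is, (C (lI j) * g j - (if eval u (g j) = 0 then C c * g j ^ 2 else 0) - 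
        g j * (C (Real.sqrt (lI j)) - C (c / (2 * Real.sqrt (lI j))) * g j) ^ 2) ∈ mI u ^ 3 := by
      refine Ideal.sum_mem _ fun j hj => ?_
      split_ifs with h0
      · have hpos : 0 < lI j := by have := hscc j hj; rw [h0] at this; linarith
        have hs : 0 < Real.sqrt (lI j) := Real.sqrt_pos.2 hpos
        have hg3 : g j ^ 3 ∈ mI u ^ 3 := Ideal.pow_mem_pow (mem_mI.2 h0) 3
        convert (mI u ^ 3).mul_mem_left (-C ((c / (2 * Real.sqrt (lI j))) ^ 2)) hg3 using 1
        have e1 : (C (lI j) : RPoly N) = C (Real.sqrt (lI j)) ^ 2 := by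
          rw [← C_pow, Real.sq_sqrt hpos.le]
        have e2 : (C c : RPoly N) = 2 * C (Real.sqrt (lI j)) * C (c / (2 * Real.sqrt (lI j))) := by
          rw [show (2 : RPoly N) = C 2 from (map_ofNat C 2).symm, ← C_mul, ← C_mul]
          congr 1; field_simp
        rw [e1, e2, C_pow]; ring
      · have : lI j = 0 := by
          rcases mul_eq_zero.1 (hl j hj).2 with h | h
          · exact h
          · exact absurd h h0
        simp [this]
    convert (mI u ^ 3).add_mem ((mI u ^ 3).add_mem ((mI u ^ 3).add_mem GT m1) m2) m3 using 1
    rw [hqH, hG]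
    simp only [Finset.sum_sub_distrib, mul_sub, mul_add]
    have e3 : ∑ j ∈ Is, (if eval u (g j) = 0 then C c * g j ^ 2 else 0) = C c * ∑ j ∈ Ia, g j ^ 2 := by
      rw [hIa, Finset.sum_filter, Finset.mul_sum]
      refine Finset.sum_congr rfl fun j _ => ?_
      split_ifs <;> simp
    rw [e3]
    have e4 : ∑ j ∈ Es, h j * (C c * h j) = C c * ∑ j ∈ Es, h j ^ 2 := by
      rw [Finset.mul_sum]; exact Finset.sum_congr rfl fun j _ => by ring
    have e5 : ∑ j ∈ Es, h j * C (lE j) = ∑ j ∈ Es, C (lE j) * h j := 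
      Finset.sum_congr rfl fun j _ => by ring
    rw [e4, e5]; ring

end PartD

section PartE
variable {N : ℕ}

/-- generators -/
def Mgen {ι κ : Type} (Es : Finset ι) (h : ι → RPoly N) (Is : Finset κ) (g : κ → RPoly N) :
    Set (RPoly N) :=
  {p | (∃ j ∈ Es, ∃ q, p = h j * q) ∨ (∃ q, p = q ^ 2) ∨ (∃ j ∈ Is, ∃ q, p = g j * q ^ 2)}

/-- the quadratic module -/
noncomputable def MM {ι κ : Type} (Es : Finset ι) (h : ι → RPoly N) (Is : Finset κ) (g : κ → RPoly N) :
    AddSubmonoid (RPoly N) := AddSubmonoid.closure (Mgen Es h Is g)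

variable {ι κ : Type} {Es : Finset ι} {h : ι → RPoly N} {Is : Finset κ} {g : κ → RPoly N}

lemma MM_h {j : ι} (hj : j ∈ Es) (q : RPoly N) : h j * q ∈ MM Es h Is g :=
  AddSubmonoid.subset_closure (Or.inl ⟨j, hj, q, rfl⟩)

lemma MM_sq (q : RPoly N) : q ^ 2 ∈ MM Es h Is g :=
  AddSubmonoid.subset_closure (Or.inr (Or.inl ⟨q, rfl⟩))

lemma MM_g {j : κ} (hj : j ∈ Is) (q : RPoly N) : g j * q ^ 2 ∈ MM Es h Is g :=
  AddSubmonoid.subset_closure (Or.inr (Or.inr ⟨j, hj, q, rfl⟩))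

lemma MM_good (hs : ∃ j ∈ Es, h j = (∑ i, X i ^ 2) - 1) : GoodM (MM Es h Is g) where
  one := by simpa using MM_sq (Es := Es) (h := h) (Is := Is) (g := g) 1
  sq := by
    intro q m hm
    induction hm using AddSubmonoid.closure_induction with
    | mem x hx =>
      rcases hx with ⟨j, hj, r, rfl⟩ | ⟨r, rfl⟩ | ⟨j, hj, r, rfl⟩
      · convert MM_h hj (q ^ 2 * r) using 1; ring
      · convert MM_sq (q * r) using 1; ring
      · convert MM_g hj (q * r) using 1; ring
    | zero => rw [mul_zero]; exact zero_mem _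
    | add x y _ _ hx hy => rw [mul_add]; exact add_mem hx hy
  sph := by
    obtain ⟨j, hj, e⟩ := hs
    intro q; rw [← e]; exact MM_h hj q

open scoped MatrixOrder in
lemma qf_psd (M : AddSubmonoid (RPoly N)) (hM : GoodM M) (H : Fin N → Fin N → ℝ) (u : Fin N → ℝ)
    (hsym : ∀ a b, H a b = H b a) (hpos : ∀ v : Fin N → ℝ, 0 ≤ ∑ a, ∑ b, H a b * (v a * v b)) :
    qf H u ∈ M := by
  have hP : Matrix.PosSemidef (Matrix.of H) := by
    refine Matrix.PosSemidef.of_dotProduct_mulVec_nonneg ?_ ?_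
    · exact Matrix.IsHermitian.ext fun a b => by simp [hsym a b]
    · intro v
      refine (hpos v).trans_eq ?_
      simp only [dotProduct, Matrix.mulVec, Finset.mul_sum]
      refine Finset.sum_congr rfl fun a _ => Finset.sum_congr rfl fun b _ => ?_
      simp only [Pi.star_apply, star_trivial, Matrix.of_apply]; ring
  obtain ⟨B, hB⟩ : ∃ B : Matrix (Fin N) (Fin N) ℝ, Matrix.of H = B.conjTranspose * B := by
    have h0 : 0 ≤ Matrix.of H := hP.nonneg
    exact CStarAlgebra.nonneg_iff_eq_star_mul_self.1 h0
  have : qf H u = ∑ r, (∑ a, C (B r a) * linP u a) ^ 2 := by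
    have e : ∀ a b, H a b = ∑ r, B r a * B r b := by
      intro a b
      have := congrFun (congrFun hB a) b
      simpa [Matrix.mul_apply] using this
    rw [show H = fun a b => ∑ r, B r a * B r b from funext fun a => funext fun b => e a b, qf_sum]
    refine Finset.sum_congr rfl fun r _ => ?_
    rw [pow_two, Finset.sum_mul_sum, qf]
    refine Finset.sum_congr rfl fun a _ => Finset.sum_congr rfl fun b _ => ?_
    rw [C_mul]; ring
  rw [this]
  exact sum_mem fun r _ => hM.sq' _

end PartE

section PartF
variable {N : ℕ}

lemma crt3 (S : Finset (Fin N → ℝ)) (x : (Fin N → ℝ) → RPoly N) :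
    ∃ r : RPoly N, ∀ u ∈ S, r - x u ∈ mI u ^ 3 := by
  obtain ⟨r, hr⟩ := Ideal.exists_forall_sub_mem_ideal (I := fun u : S => mI u.1 ^ 3)
    (fun u v huv => IsCoprime.pow (mI_coprime fun e => huv (Subtype.ext e))) (fun u => x u.1)
  exact ⟨r, fun u hu => hr ⟨u, hu⟩⟩

/-- vanishing ideal of a finite set -/
noncomputable def vI (S : Finset (Fin N → ℝ)) : Ideal (RPoly N) := ∏ u ∈ S, mI u

lemma mem_vI {S : Finset (Fin N → ℝ)} {b : RPoly N} : b ∈ vI S ↔ ∀ u ∈ S, eval u b = 0 := by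
  rw [vI, Ideal.prod_eq_iInf_of_pairwise_isCoprime (fun u _ v _ huv => mI_coprime huv)]
  simp [Ideal.mem_iInf, mem_mI]

lemma mem_vI_sq {S : Finset (Fin N → ℝ)} {b : RPoly N} : b ∈ vI S ^ 2 ↔ ∀ u ∈ S, b ∈ mI u ^ 2 := by
  rw [vI, ← Finset.prod_pow, Ideal.prod_eq_iInf_of_pairwise_isCoprime
    (fun u _ v _ huv => IsCoprime.pow (mI_coprime huv))]
  simp [Ideal.mem_iInf]

lemma delta (S : Finset (Fin N → ℝ)) (u : Fin N → ℝ) (hu : u ∈ S) :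
    ∃ e : RPoly N, eval u e = 1 ∧ ∀ v ∈ S, v ≠ u → eval v e = 0 := by
  classical
  obtain ⟨r, hr⟩ := crt3 S (fun v => if v = u then 1 else 0)
  have h1 : ∀ v ∈ S, eval v r = eval v (if v = u then (1 : RPoly N) else 0) := by
    intro v hv
    have := mem_mI.1 (Ideal.pow_le_self (by norm_num) (hr v hv))
    rw [map_sub] at this; linarith
  refine ⟨r, by simpa using h1 u hu, fun v hv hne => by simpa [hne] using h1 v hv⟩

/-- case `x = u ∈ S` of the pure state argument -/
lemma state_at (M : AddSubmonoid (RPoly N)) (hM : GoodM M) (S : Finset (Fin N → ℝ))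
    (t : Finset (RPoly N)) (ht : ∀ s ∈ t, s ∈ vI S) (R : RPoly N)
    (hQJ : ∑ s ∈ t, s ^ 2 ∈ vI S ^ 2) (hRJ : R ∈ vI S ^ 2)
    (u : Fin N → ℝ) (hu : u ∈ S) (hPD : PDjet u R)
    (φ : ↥(vI S ^ 2) →ₗ[ℝ] ℝ) (hpos : ∀ b : ↥(vI S ^ 2), (b : RPoly N) ∈ M → 0 ≤ φ b)
    (hQ1 : φ ⟨_, hQJ⟩ = 1) (hmul : ∀ (a : RPoly N) (b : ↥(vI S ^ 2)), φ (a • b) = eval u a * φ b) :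
    0 < φ ⟨R, hRJ⟩ := by
  obtain ⟨e, he1, he0⟩ := delta S u hu
  have heI : Ideal.span {e} * mI u ≤ vI S := by
    rw [Ideal.span_singleton_mul_le_iff]
    intro z hz
    rw [mem_vI]
    intro v hv
    by_cases hvu : v = u
    · rw [hvu, map_mul, mem_mI.1 hz, mul_zero]
    · rw [map_mul, he0 v hv hvu, zero_mul]
  have heJ : ∀ b ∈ mI u ^ 2, e ^ 2 * b ∈ vI S ^ 2 := by
    intro b hb
    have := Ideal.pow_right_mono heI 2
    rw [mul_pow, Ideal.span_singleton_pow] at this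
    exact this (Ideal.mul_mem_mul (Ideal.mem_span_singleton_self _) hb)
  have h3 : ∀ c (hc : c ∈ mI u ^ 3), ∃ hc' : e ^ 2 * c ∈ vI S ^ 2, φ ⟨e ^ 2 * c, hc'⟩ = 0 := by
    intro c hc
    rw [pow_succ'] at hc
    refine Submodule.mul_induction_on hc ?_ ?_
    · intro a ha b hb
      refine ⟨heJ _ (Ideal.mul_mem_left _ _ hb), ?_⟩
      have := hmul a ⟨e ^ 2 * b, heJ b hb⟩
      rw [mem_mI.1 ha, zero_mul] at this
      rw [← this]
      congr 1
      apply Subtype.ext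
      simp [mul_left_comm]
    · rintro x y ⟨hx, hx'⟩ ⟨hy, hy'⟩
      refine ⟨by rw [mul_add]; exact add_mem hx hy, ?_⟩
      have := φ.map_add ⟨_, hx⟩ ⟨_, hy⟩
      rw [hx', hy', add_zero] at this
      rw [← this]
      congr 1
      apply Subtype.ext
      simp [mul_add]
  have hself : ∀ b : ↥(vI S ^ 2), φ b = φ ((e ^ 2) • b) := by
    intro b; rw [hmul, map_pow, he1]; simp
  -- positivity for positive jets
  have hjet : ∀ b : ↥(vI S ^ 2), ∀ H : Fin N → Fin N → ℝ, (b : RPoly N) - qf H u ∈ mI u ^ 3 →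
      qf H u ∈ M → 0 ≤ φ b := by
    intro b H hb hq
    obtain ⟨h1, h2⟩ := h3 _ hb
    have h4 : 0 ≤ φ ⟨e ^ 2 * qf H u, heJ _ (qf_mem H u)⟩ := hpos _ (hM.sq _ _ hq)
    have h5 : (e ^ 2) • b = ⟨e ^ 2 * qf H u, heJ _ (qf_mem H u)⟩ + ⟨_, h1⟩ := by
      apply Subtype.ext; simp only [SetLike.val_smul, smul_eq_mul, Submodule.coe_add]; ring
    rw [hself, h5, map_add, h2, add_zero]
    exact h4
  obtain ⟨H, hsym, hHp, hH3⟩ := hPD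
  let HQ : Fin N → Fin N → ℝ := fun a b => ∑ s ∈ t, gradP s u a * gradP s u b
  have hQ3 : ∑ s ∈ t, s ^ 2 - qf HQ u ∈ mI u ^ 3 := by
    rw [qf_sum, ← Finset.sum_sub_distrib]
    refine Ideal.sum_mem _ fun s hs => ?_
    rw [qf_rank1]
    exact sq_jet s u (mem_vI.1 (ht s hs) u hu)
  obtain ⟨c, hc, hcp⟩ := compact_quad (a := fun v => - ∑ a, ∑ b, HQ a b * (v a * v b))
    (b := fun v => ∑ a, ∑ b, H a b * (v a * v b)) (cont_quad HQ).neg (cont_quad H)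
    (fun x => by
      by_cases hx : x = 0
      · simp [hx]
      · exact (hHp x hx).le)
    (fun x hx h0 => absurd h0 (hHp x hx).ne')
    (fun r x => by rw [quad_smul]; ring) (quad_smul H)
  have hfin : 0 ≤ φ (c • ⟨R, hRJ⟩ - ⟨_, hQJ⟩) := by
    refine hjet _ (fun a b => c * H a b + (-1) * HQ a b) ?_ ?_
    · rw [qf_add, qf_smul, qf_smul]
      convert (mI u ^ 3).sub_mem ((mI u ^ 3).mul_mem_left (C c) hH3) hQ3 using 1
      have : ((c • (⟨R, hRJ⟩ : ↥(vI S ^ 2)) : ↥(vI S ^ 2)) : RPoly N) = C c * R := by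
        rw [← smul_eq_C_mul]; rfl
      rw [AddSubgroupClass.coe_sub, this, C_neg, C_1]; ring
    · refine qf_psd M hM _ u ?_ ?_
      · intro a b
        simp only [HQ]
        rw [hsym a b]
        congr 2
        exact Finset.sum_congr rfl fun _ _ => mul_comm _ _
      · intro v
        by_cases hv : v = 0
        · simp [hv]
        · refine (hcp v hv).le.trans_eq ?_
          simp only [add_mul, Finset.sum_add_distrib, Finset.mul_sum, ← Finset.sum_neg_distrib]
          rw [add_comm]
          congr 1 <;> exact Finset.sum_congr rfl fun _ _ => Finset.sum_congr rfl fun _ _ => by ring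
  rw [map_sub, map_smul, hQ1, smul_eq_mul] at hfin
  by_contra hcon
  push Not at hcon
  nlinarith

end PartF

section PartG
variable {N : ℕ}

/-- feasible set -/
def Kf {ι κ : Type} (Es : Finset ι) (h : ι → RPoly N) (Is : Finset κ) (g : κ → RPoly N) :
    Set (Fin N → ℝ) := {x | (∀ j ∈ Es, eval x (h j) = 0) ∧ ∀ j ∈ Is, 0 ≤ eval x (g j)}

variable {ι κ : Type} {Es : Finset ι} {h : ι → RPoly N} {Is : Finset κ} {g : κ → RPoly N}

lemma Kf_compact (hs : ∃ j ∈ Es, h j = (∑ i, X i ^ 2) - 1) : IsCompact (Kf Es h Is g) := by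
  apply Metric.isCompact_of_isClosed_isBounded
  · have : Kf Es h Is g = (⋂ j ∈ Es, {x | eval x (h j) = 0}) ∩ ⋂ j ∈ Is, {x | 0 ≤ eval x (g j)} := by
      ext x; simp [Kf]
    rw [this]
    refine IsClosed.inter ?_ ?_
    · exact isClosed_biInter fun j _ => isClosed_eq (MvPolynomial.continuous_eval _) continuous_const
    · exact isClosed_biInter fun j _ => isClosed_le continuous_const (MvPolynomial.continuous_eval _)
  · refine (Metric.isBounded_closedBall (x := (0 : Fin N → ℝ)) (r := 1)).subset ?_
    rintro x ⟨hx, -⟩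
    obtain ⟨j, hj, e⟩ := hs
    have h1 := hx j hj
    rw [e] at h1
    simp only [map_sub, map_sum, map_pow, eval_X, map_one] at h1
    rw [mem_closedBall_zero_iff, pi_norm_le_iff_of_nonneg zero_le_one]
    intro i
    have h2 := Finset.single_le_sum (f := fun i => x i ^ 2) (fun i _ => sq_nonneg _) (Finset.mem_univ i)
    have h3 : x i ^ 2 ≤ 1 := by linarith
    exact abs_le_one_iff_mul_self_le_one.2 (by nlinarith)

lemma strict_cert (hs : ∃ j ∈ Es, h j = (∑ i, X i ^ 2) - 1) (S : Finset (Fin N → ℝ)) (R : RPoly N)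
    (hPD : ∀ u ∈ S, PDjet u R) (hpos : ∀ x ∈ Kf Es h Is g, x ∉ S → 0 < eval x R)
    (b : RPoly N) (hb : ∀ u ∈ S, eval u b = 0) :
    ∃ c : ℝ, 0 < c ∧ C c * R - b ^ 2 ∈ MM Es h Is g := by
  have hM := MM_good (Is := Is) (g := g) hs
  obtain ⟨t, ht⟩ : (vI S).FG := IsNoetherian.noetherian _
  have ht' : ∀ s ∈ t, s ∈ vI S := fun s hs => ht ▸ Ideal.subset_span hs
  have hRJ : R ∈ vI S ^ 2 := mem_vI_sq.2 fun u hu => (hPD u hu).mem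
  have hQJ : ∑ s ∈ t, s ^ 2 ∈ vI S ^ 2 := Ideal.sum_mem _ fun s hs => Ideal.pow_mem_pow (ht' s hs) 2
  have hQM : ∑ s ∈ t, s ^ 2 ∈ MM Es h Is g := sum_mem fun s _ => hM.sq' s
  have hou : ∀ b ∈ vI S ^ 2, ∃ c : ℝ, 0 ≤ c ∧ C c * (∑ s ∈ t, s ^ 2) - b ∈ MM Es h Is g := by
    intro b hb
    obtain ⟨c, hc, h1, -⟩ := hM.order_unit t b (by rw [show Ideal.span (t : Set (RPoly N)) = vI S from ht]; exact hb)
    exact ⟨c, hc, h1⟩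
  have claim : ∃ ε : ℝ, 0 < ε ∧ R - C ε * (∑ s ∈ t, s ^ 2) ∈ MM Es h Is g := by
    by_contra hcon
    push Not at hcon
    obtain ⟨φ, x, hφ, hφQ, hφR, hmul⟩ := hM.pure _ _ R hQJ hRJ hQM hou hcon
    have hxK : x ∈ Kf Es h Is g := by
      constructor
      · intro j hj
        have e : eval x (h j) = φ (h j • ⟨_, hQJ⟩) := by rw [hmul, hφQ, mul_one]
        have e' : -eval x (h j) = φ ((-h j) • ⟨_, hQJ⟩) := by rw [hmul, hφQ, mul_one, map_neg]
        have h1 : 0 ≤ eval x (h j) := by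
          rw [e]; exact hφ _ (MM_h hj _)
        have h2 : 0 ≤ -eval x (h j) := by
          rw [e']; refine hφ _ ?_
          simp only [SetLike.val_smul, smul_eq_mul]
          rw [neg_mul, ← mul_neg]
          exact MM_h hj _
        linarith
      · intro j hj
        have e : eval x (g j) = φ (g j • ⟨_, hQJ⟩) := by rw [hmul, hφQ, mul_one]
        rw [e]; refine hφ _ ?_
        simp only [SetLike.val_smul, smul_eq_mul]
        rw [Finset.mul_sum]
        exact sum_mem fun s _ => MM_g hj s
    by_cases hxS : x ∈ S
    · exact absurd hφR (not_le.2 (state_at _ hM S t ht' R hQJ hRJ x hxS (hPD x hxS) φ hφ hφQ hmul))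
    · have h1 := hpos x hxK hxS
      have h2 : φ ((∑ s ∈ t, s ^ 2) • ⟨R, hRJ⟩) = φ (R • ⟨_, hQJ⟩) := by
        congr 1; apply Subtype.ext; simp only [SetLike.val_smul, smul_eq_mul]; ring
      rw [hmul, hmul, hφQ, mul_one] at h2
      have h3 : 0 ≤ eval x (∑ s ∈ t, s ^ 2) := by
        simp only [map_sum, map_pow]; positivity
      nlinarith
  obtain ⟨ε, hε, hεM⟩ := claim
  obtain ⟨c, hc, hcM⟩ := hou (b ^ 2) (Ideal.pow_mem_pow (mem_vI.2 hb) 2)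
  refine ⟨(c + 1) / ε, by positivity, ?_⟩
  have := add_mem (add_mem (hM.smul (r := (c + 1) / ε) (by positivity) hεM) hcM) hQM
  convert this using 1
  rw [mul_sub, ← mul_assoc, ← C_mul, div_mul_cancel₀ _ hε.ne', C_add, C_1]; ring

end PartG

section PartH
variable {N : ℕ} {ι κ : Type} {Es : Finset ι} {h : ι → RPoly N} {Is : Finset κ} {g : κ → RPoly N}

lemma finite_zeros (hs : ∃ j ∈ Es, h j = (∑ i, X i ^ 2) - 1) (F : RPoly N)
    (hopt : ∀ u ∈ Kf Es h Is g, eval u F = 0 → OptCondsAt Es h Is g F u) :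
    ∃ S : Finset (Fin N → ℝ), ∀ x, x ∈ S ↔ x ∈ Kf Es h Is g ∧ eval x F = 0 := by
  classical
  have hK := Kf_compact (Is := Is) (g := g) hs
  have hS0 : IsCompact (Kf Es h Is g ∩ {x | eval x F = 0}) :=
    hK.inter_right (isClosed_eq (MvPolynomial.continuous_eval _) continuous_const)
  have key : ∀ u ∈ Kf Es h Is g ∩ {x | eval x F = 0}, ∀ᶠ x in nhds u, x ≠ u →
      ¬ (x ∈ Kf Es h Is g ∧ eval x F = 0) := by
    rintro u ⟨hu, hu0⟩
    obtain ⟨p, q, hR⟩ := local_cert Es h Is g F u hu.1 hu0 (hopt u hu hu0)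
    filter_upwards [hR.local_pos] with x hx hne
    rintro ⟨hxK, hx0⟩
    have := hx hne
    simp only [map_sub, map_sum, map_mul, map_pow, hx0] at this
    rw [Finset.sum_eq_zero fun j hj => by rw [hxK.1 j hj, zero_mul]] at this
    have h2 : 0 ≤ ∑ j ∈ Is, eval x (g j) * eval x (q j) ^ 2 :=
      Finset.sum_nonneg fun j hj => mul_nonneg (hxK.2 j hj) (sq_nonneg _)
    linarith
  obtain ⟨t, ht, hcov⟩ := hS0.elim_nhds_subcover
    (fun u => {x | x ≠ u → ¬ (x ∈ Kf Es h Is g ∧ eval x F = 0)}) key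
  refine ⟨t.filter (fun x => x ∈ Kf Es h Is g ∧ eval x F = 0), fun x => ?_⟩
  rw [Finset.mem_filter]
  refine ⟨fun h => h.2, fun hx => ⟨?_, hx⟩⟩
  have := hcov hx
  simp only [Set.mem_iUnion] at this
  obtain ⟨u, hu, hxu⟩ := this
  by_contra hcon
  have hne : x ≠ u := by rintro rfl; exact hcon hu
  exact hxu hne hx

lemma exists_R0 (F : RPoly N) (S : Finset (Fin N → ℝ)) 
    (hS : ∀ x, x ∈ S ↔ x ∈ Kf Es h Is g ∧ eval x F = 0)
    (hopt : ∀ u ∈ Kf Es h Is g, eval u F = 0 → OptCondsAt Es h Is g F u) :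
    ∃ (p : ι → RPoly N) (q : κ → RPoly N), ∀ u ∈ S,
      PDjet u (F - ∑ j ∈ Es, h j * p j - ∑ j ∈ Is, g j * q j ^ 2) := by
  have h1 : ∀ u, ∃ (p : ι → RPoly N) (q : κ → RPoly N), u ∈ S → 
      PDjet u (F - ∑ j ∈ Es, h j * p j - ∑ j ∈ Is, g j * q j ^ 2) := by
    intro u
    by_cases hu : u ∈ S
    · obtain ⟨hK, h0⟩ := (hS u).1 hu
      obtain ⟨p, q, hR⟩ := local_cert Es h Is g F u hK.1 h0 (hopt u hK h0)
      exact ⟨p, q, fun _ => hR⟩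
    · exact ⟨0, 0, fun h => absurd h hu⟩
  choose p q hpq using h1
  choose P hP using fun j => crt3 S (fun u => p u j)
  choose Q hQ using fun j => crt3 S (fun u => q u j)
  refine ⟨P, Q, fun u hu => (hpq u hu).congr ?_⟩
  have m1 : ∑ j ∈ Es, h j * (P j - p u j) ∈ mI u ^ 3 :=
    Ideal.sum_mem _ fun j _ => Ideal.mul_mem_left _ _ (hP j u hu)
  have m2 : ∑ j ∈ Is, g j * (Q j + q u j) * (Q j - q u j) ∈ mI u ^ 3 :=
    Ideal.sum_mem _ fun j _ => Ideal.mul_mem_left _ _ (hQ j u hu)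
  convert (mI u ^ 3).neg_mem ((mI u ^ 3).add_mem m1 m2) using 1
  have e : ∑ j ∈ Is, g j * (Q j + q u j) * (Q j - q u j) = ∑ j ∈ Is, g j * Q j ^ 2 - ∑ j ∈ Is, g j * q u j ^ 2 := by
    rw [← Finset.sum_sub_distrib]; exact Finset.sum_congr rfl fun j _ => by ring
  rw [e]
  simp only [mul_sub, Finset.sum_sub_distrib]
  ring

/-- analytic selection of the power -/
lemma exists_theta (K : Set (Fin N → ℝ)) (hK : IsCompact K) (S : Finset (Fin N → ℝ)) :
    ∃ θ : RPoly N, (∀ u ∈ S, 1 - θ ∈ mI u ^ 2) ∧ (∀ x ∈ K, 0 ≤ eval x θ ∧ eval x θ ≤ 1) ∧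
      ∀ x ∈ K, x ∉ S → eval x θ < 1 := by
  set P : RPoly N := ∏ u ∈ S, ∑ a, linP u a ^ 2 with hP
  have hPm : ∀ u ∈ S, P ∈ mI u ^ 2 := by
    intro u hu
    obtain ⟨z, hz⟩ := Finset.dvd_prod_of_mem (fun u => ∑ a, linP u a ^ 2) hu
    rw [hP, hz]
    exact Ideal.mul_mem_right _ _ (Ideal.sum_mem _ fun a _ => Ideal.pow_mem_pow (linP_mem u a) 2)
  have hPe : ∀ x, eval x P = ∏ u ∈ S, ∑ a, (x a - u a) ^ 2 := by
    intro x; simp [hP, eval_linP, map_prod]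
  obtain ⟨A, hA⟩ := hK.bddAbove_image (f := fun x => eval x P) (MvPolynomial.continuous_eval _).continuousOn
  have hA' : ∀ x ∈ K, eval x P ≤ max A 1 := fun x hx => (hA (Set.mem_image_of_mem _ hx)).trans (le_max_left _ _)
  have hA0 : 0 < max A 1 := lt_of_lt_of_le one_pos (le_max_right _ _)
  refine ⟨1 - C (1 / max A 1) * P, ?_, ?_, ?_⟩
  · intro u hu
    rw [sub_sub_cancel]; exact Ideal.mul_mem_left _ _ (hPm u hu)
  · intro x hx
    have h0 : 0 ≤ eval x P := by rw [hPe]; positivity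
    have h1 : 1 / max A 1 * eval x P ≤ 1 := by
      rw [one_div, inv_mul_le_iff₀ hA0]; linarith [hA' x hx]
    simp only [map_sub, map_one, map_mul, eval_C]
    exact ⟨by linarith, by have := mul_nonneg (one_div_pos.2 hA0).le h0; linarith⟩
  · intro x hx hxS
    have h0 : 0 < eval x P := by
      rw [hPe]
      refine Finset.prod_pos fun u hu => ?_
      have hne : x ≠ u := by rintro rfl; exact hxS hu
      obtain ⟨a, ha⟩ := Function.ne_iff.1 hne
      refine Finset.sum_pos' (fun a _ => sq_nonneg _) ⟨a, Finset.mem_univ _, ?_⟩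
      have := sub_ne_zero.2 ha
      positivity
    simp only [map_sub, map_one, map_mul, eval_C]
    have := mul_pos (one_div_pos.2 hA0) h0
    linarith

lemma exists_power (K : Set (Fin N → ℝ)) (hK : IsCompact K) (S : Finset (Fin N → ℝ)) (F R θ : RPoly N)
    (hF : ∀ x ∈ K, 0 ≤ eval x F) (hF0 : ∀ x ∈ K, x ∉ S → 0 < eval x F)
    (hR : ∀ u ∈ S, PDjet u R) (h01 : ∀ x ∈ K, 0 ≤ eval x θ ∧ eval x θ ≤ 1)
    (h1 : ∀ x ∈ K, x ∉ S → eval x θ < 1) :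
    ∃ m : ℕ, ∀ x ∈ K, x ∉ S → 0 < eval x (F - (θ ^ m) ^ 2 * (F - R)) := by
  have hV : ∀ u ∈ S, ∃ V : Set (Fin N → ℝ), IsOpen V ∧ u ∈ V ∧ ∀ x ∈ V, x ≠ u → 0 < eval x R := by
    intro u hu
    obtain ⟨V, hV, hVo, huV⟩ := eventually_nhds_iff.1 (hR u hu).local_pos
    exact ⟨V, hVo, huV, hV⟩
  choose! V hVo huV hVR using hV
  set W := ⋃ u ∈ S, V u with hW
  have hWo : IsOpen W := isOpen_biUnion fun u hu => hVo u hu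
  have hWR : ∀ x ∈ W, x ∉ S → 0 < eval x R := by
    intro x hx hxS
    simp only [hW, Set.mem_iUnion] at hx
    obtain ⟨u, hu, hxu⟩ := hx
    exact hVR u hu x hxu (by rintro rfl; exact hxS hu)
  have hSW : ∀ x, x ∉ W → x ∉ S := by
    intro x hx hxS
    exact hx (Set.mem_biUnion hxS (huV x hxS))
  have hL : IsCompact (K \ W) := hK.diff hWo
  -- estimate away from S
  have hm : ∃ m : ℕ, ∀ x ∈ K \ W, eval x θ ^ (2 * m) * |eval x (F - R)| < eval x F := by
    rcases (K \ W).eq_empty_or_nonempty with h | hne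
    · exact ⟨0, by simp [h]⟩
    obtain ⟨x1, hx1, hx1m⟩ := hL.exists_isMinOn hne (f := fun x => eval x F) (MvPolynomial.continuous_eval _).continuousOn
    obtain ⟨x2, hx2, hx2m⟩ := hL.exists_isMaxOn hne (f := fun x => eval x θ) (MvPolynomial.continuous_eval _).continuousOn
    obtain ⟨x3, hx3, hx3m⟩ := hL.exists_isMaxOn hne (f := fun x => |eval x (F - R)|)
      (MvPolynomial.continuous_eval _).abs.continuousOn
    have d1 := hF0 x1 hx1.1 (hSW _ hx1.2)
    have d2 := h1 x2 hx2.1 (hSW _ hx2.2)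
    have d3 := (h01 x2 hx2.1).1
    have htend : Filter.Tendsto (fun m : ℕ => eval x2 θ ^ m * |eval x3 (F - R)|) Filter.atTop (nhds (0 * |eval x3 (F - R)|)) :=
      (tendsto_pow_atTop_nhds_zero_of_lt_one d3 d2).mul_const _
    rw [zero_mul] at htend
    obtain ⟨m, hm⟩ := Filter.eventually_atTop.1 (htend.eventually (gt_mem_nhds d1))
    refine ⟨m, fun x hx => ?_⟩
    have e1 : eval x θ ^ (2 * m) ≤ eval x2 θ ^ (2 * m) := pow_le_pow_left₀ (h01 x hx.1).1 (hx2m hx) _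
    have e2 : |eval x (F - R)| ≤ |eval x3 (F - R)| := hx3m hx
    have e3 : eval x1 F ≤ eval x F := hx1m hx
    calc _ ≤ eval x2 θ ^ (2 * m) * |eval x3 (F - R)| :=
          mul_le_mul e1 e2 (abs_nonneg _) (pow_nonneg d3 _)
      _ < eval x1 F := hm (2 * m) (by omega)
      _ ≤ _ := e3
  obtain ⟨m, hm⟩ := hm
  refine ⟨m, fun x hx hxS => ?_⟩
  by_cases hxW : x ∈ W
  · simp only [map_sub, map_mul, map_pow]
    have r := hWR x hxW hxS
    have f := hF0 x hx hxS
    have t1 : (eval x θ ^ m) ^ 2 ≤ 1 := by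
      rw [← pow_mul]; exact pow_le_one₀ (h01 x hx).1 (h01 x hx).2
    have t0 : 0 ≤ (eval x θ ^ m) ^ 2 := sq_nonneg _
    generalize (eval x θ ^ m) ^ 2 = s at *
    rcases t0.eq_or_lt with h | h
    · rw [← h]; linarith
    · nlinarith [mul_pos h r, mul_nonneg (sub_nonneg.2 t1) f.le]
  · have := hm x ⟨hx, hxW⟩
    have e : eval x (F - (θ ^ m) ^ 2 * (F - R)) = eval x F - eval x θ ^ (2 * m) * eval x (F - R) := by
      simp only [map_sub, map_mul, map_pow, ← pow_mul, mul_comm m 2]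
    rw [e]
    have := mul_le_mul_of_nonneg_left (le_abs_self (eval x (F - R))) (pow_nonneg (h01 x hx).1 (2 * m))
    linarith

theorem core (hs : ∃ j ∈ Es, h j = (∑ i, X i ^ 2) - 1) (F : RPoly N)
    (hF : ∀ x ∈ Kf Es h Is g, 0 ≤ eval x F)
    (hopt : ∀ u ∈ Kf Es h Is g, eval u F = 0 → OptCondsAt Es h Is g F u) :
    ∃ S : Finset (Fin N → ℝ), ∀ b : RPoly N, (∀ u ∈ S, eval u b = 0) →
      ∃ c : ℝ, 0 < c ∧ C c * F - b ^ 2 ∈ MM Es h Is g := by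
  have hM := MM_good (Is := Is) (g := g) hs
  have hK := Kf_compact (Is := Is) (g := g) hs
  obtain ⟨S, hS⟩ := finite_zeros hs F hopt
  obtain ⟨p, q, hR⟩ := exists_R0 F S hS hopt
  obtain ⟨θ, hθ1, hθ2, hθ3⟩ := exists_theta _ hK S
  obtain ⟨R, hRdef⟩ : ∃ R, R = F - ∑ j ∈ Es, h j * p j - ∑ j ∈ Is, g j * q j ^ 2 := ⟨_, rfl⟩
  rw [← hRdef] at hR
  obtain ⟨m, hm⟩ := exists_power _ hK S F R θ hF
    (fun x hx hxS => lt_of_le_of_ne (hF x hx) fun e => hxS ((hS x).2 ⟨hx, e.symm⟩)) hR hθ2 hθ3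
  refine ⟨S, fun b hb => ?_⟩
  have hR' : ∀ u ∈ S, PDjet u (F - (θ ^ m) ^ 2 * (F - R)) := by
    intro u hu
    refine (hR u hu).congr ?_
    have k1 : F - R ∈ mI u := (mI u).sub_mem (mem_mI.2 ((hS u).1 hu).2) 
      (Ideal.pow_le_self (by norm_num) (hR u hu).mem)
    have k2 : 1 - (θ ^ m) ^ 2 ∈ mI u ^ 2 := by
      rw [← pow_mul]
      exact Ideal.mem_of_dvd _ (one_sub_dvd_one_sub_pow θ _) (hθ1 u hu)
    rw [pow_succ]
    convert Ideal.mul_mem_mul k2 k1 using 1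
    ring
  obtain ⟨c, hc, hcM⟩ := strict_cert hs S _ hR' hm b hb
  · refine ⟨c, hc, ?_⟩
    have h2 : (θ ^ m) ^ 2 * (F - R) ∈ MM Es h Is g := by
      have : F - R = ∑ j ∈ Es, h j * p j + ∑ j ∈ Is, g j * q j ^ 2 := by rw [hRdef]; ring
      rw [this]
      exact hM.sq _ _ (add_mem (sum_mem fun j hj => MM_h hj _) (sum_mem fun j hj => MM_g hj _))
    convert add_mem hcM (hM.smul hc.le h2) using 1
    ring

end PartH

section PartI
variable {N : ℕ} {ι κ : Type} {Es : Finset ι} {h : ι → RPoly N} {Is : Finset κ} {g : κ → RPoly N}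

lemma pairing_superset (p : RPoly N) (w : (Fin N →₀ ℕ) → ℝ) (T : Finset (Fin N →₀ ℕ))
    (hT : p.support ⊆ T) : pairing p w = ∑ α ∈ T, p.coeff α * w α := by
  refine Finset.sum_subset hT fun α _ hα => ?_
  rw [notMem_support_iff.1 hα, zero_mul]

/-- the Riesz functional -/
noncomputable def pairL (w : (Fin N →₀ ℕ) → ℝ) : RPoly N →ₗ[ℝ] ℝ where
  toFun p := pairing p w
  map_add' p q := by
    classical
    rw [pairing_superset p w (p.support ∪ q.support) Finset.subset_union_left,
      pairing_superset q w (p.support ∪ q.support) Finset.subset_union_right,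
      pairing_superset (p + q) w (p.support ∪ q.support) support_add, ← Finset.sum_add_distrib]
    exact Finset.sum_congr rfl fun α _ => by rw [coeff_add, add_mul]
  map_smul' r p := by
    rw [pairing_superset (r • p) w p.support support_smul]
    simp only [pairing, coeff_smul, smul_eq_mul, RingHom.id_apply, Finset.mul_sum, mul_assoc]

lemma pairL_apply (w : (Fin N →₀ ℕ) → ℝ) (p : RPoly N) : pairL w p = pairing p w := rfl

lemma pairL_C_mul (w : (Fin N →₀ ℕ) → ℝ) (r : ℝ) (p : RPoly N) : pairL w (C r * p) = r * pairL w p := by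
  rw [← smul_eq_C_mul, map_smul, smul_eq_mul]

lemma pairL_monomial (w : (Fin N →₀ ℕ) → ℝ) (α : Fin N →₀ ℕ) (r : ℝ) :
    pairL w (monomial α r) = r * w α := by
  classical
  rw [pairL_apply, pairing_superset _ w {α} support_monomial_subset]
  simp

lemma pairing_point (x : Fin N → ℝ) (r : ℝ) (p : RPoly N) :
    pairing p (fun α => r * ∏ i, x i ^ α i) = r * eval x p := by
  rw [eval_eq', pairing, Finset.mul_sum]
  exact Finset.sum_congr rfl fun α _ => by ring

lemma mm_pair {p : RPoly N} (hp : p ∈ MM Es h Is g) :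
    ∃ k0 : ℕ, ∀ k, k0 ≤ k → ∀ w, MomRelaxPSD Es h Is g k w → 0 ≤ pairing p w := by
  induction hp using AddSubmonoid.closure_induction with
  | mem x hx =>
    rcases hx with ⟨j, hj, q, rfl⟩ | ⟨q, rfl⟩ | ⟨j, hj, q, rfl⟩
    · exact ⟨q.totalDegree + (h j).totalDegree, fun k hk w hw => (hw.1 j hj q (by omega)).ge⟩
    · exact ⟨q.totalDegree, fun k hk w hw => hw.2.2 q hk⟩
    · exact ⟨q.totalDegree + ((g j).totalDegree + 1) / 2, fun k hk w hw => hw.2.1 j hj q hk⟩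
  | zero => exact ⟨0, fun k _ w _ => by simp [pairing]⟩
  | add x y _ _ hx hy =>
    obtain ⟨a, ha⟩ := hx
    obtain ⟨b, hb⟩ := hy
    refine ⟨max a b, fun k hk w hw => ?_⟩
    rw [← pairL_apply, map_add]
    exact add_nonneg (ha k (le_trans (le_max_left _ _) hk) w hw) (hb k (le_trans (le_max_right _ _) hk) w hw)

lemma IsSOS.add {p q : RPoly N} (hp : IsSOS p) (hq : IsSOS q) : IsSOS (p + q) := by
  obtain ⟨L, rfl⟩ := hp
  obtain ⟨L', rfl⟩ := hq
  exact ⟨L ++ L', by simp⟩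

lemma isSOS_zero : IsSOS (0 : RPoly N) := ⟨[], by simp⟩
lemma isSOS_sq (q : RPoly N) : IsSOS (q ^ 2) := ⟨[q], by simp⟩

lemma IdealDeg.add {k : ℕ} {p q : RPoly N} (hp : p ∈ IdealDeg Es h k) (hq : q ∈ IdealDeg Es h k) :
    p + q ∈ IdealDeg Es h k := by
  obtain ⟨a, ha, rfl⟩ := hp
  obtain ⟨b, hb, rfl⟩ := hq
  refine ⟨fun j => a j + b j, fun j hj => ?_, ?_⟩
  · have := totalDegree_add (a j) (b j)
    have := ha j hj
    have := hb j hj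
    dsimp only
    omega
  · simp only [mul_add, Finset.sum_add_distrib]

lemma QModDeg.add {k : ℕ} {p q : RPoly N} (hp : p ∈ QModDeg Is g k) (hq : q ∈ QModDeg Is g k) :
    p + q ∈ QModDeg Is g k := by
  obtain ⟨a0, a, ha0, ha0', ha, rfl⟩ := hp
  obtain ⟨b0, b, hb0, hb0', hb, rfl⟩ := hq
  refine ⟨a0 + b0, fun j => a j + b j, ha0.add hb0, ?_, fun j hj => ⟨(ha j hj).1.add (hb j hj).1, ?_⟩, ?_⟩
  · have := totalDegree_add a0 b0
    omega
  · have := totalDegree_add (a j) (b j)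
    have := (ha j hj).2
    have := (hb j hj).2
    dsimp only
    omega
  · simp only [mul_add, Finset.sum_add_distrib]; ring

lemma mm_deg {p : RPoly N} (hp : p ∈ MM Es h Is g) :
    ∃ k0 : ℕ, ∀ k, k0 ≤ k → ∃ p1 ∈ IdealDeg Es h (2 * k), ∃ p2 ∈ QModDeg Is g (2 * k), p = p1 + p2 := by
  classical
  have hE : ∀ j ∈ Es, (h j).totalDegree ≤ Es.sup fun j => (h j).totalDegree :=
    fun j hj => Finset.le_sup (f := fun j => (h j).totalDegree) hj
  have hI : ∀ j ∈ Is, (g j).totalDegree ≤ Is.sup fun j => (g j).totalDegree :=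
    fun j hj => Finset.le_sup (f := fun j => (g j).totalDegree) hj
  have zI : ∀ k, (Es.sup fun j => (h j).totalDegree) ≤ k → (0 : RPoly N) ∈ IdealDeg Es h (2 * k) := by
    intro k hk
    refine ⟨0, fun j hj => ?_, by simp⟩
    have := hE j hj
    simp; omega
  have zQ : ∀ k, (Is.sup fun j => (g j).totalDegree) ≤ k → ∀ q : RPoly N, q.totalDegree ≤ k → 
      q ^ 2 ∈ QModDeg Is g (2 * k) := by
    intro k hk q hq
    refine ⟨q ^ 2, 0, isSOS_sq q, ?_, fun j hj => ⟨isSOS_zero, ?_⟩, by simp⟩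
    · have := totalDegree_pow q 2; omega
    · have := hI j hj
      simp; omega
  have zQ0 : ∀ k, (Is.sup fun j => (g j).totalDegree) ≤ k → (0 : RPoly N) ∈ QModDeg Is g (2 * k) := by
    intro k hk
    simpa using zQ k hk 0 (by simp)
  induction hp using AddSubmonoid.closure_induction with
  | mem x hx =>
    rcases hx with ⟨j, hj, q, rfl⟩ | ⟨q, rfl⟩ | ⟨j, hj, q, rfl⟩
    · refine ⟨q.totalDegree + (Es.sup fun j => (h j).totalDegree) + Is.sup fun j => (g j).totalDegree,
        fun k hk => ⟨h j * q, ⟨fun i => if i = j then q else 0, fun i hi => ?_, ?_⟩, 0, zQ0 k (by omega), by simp⟩⟩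
      · have := hE i hi
        dsimp only
        split_ifs
        · omega
        · simp; omega
      · simp [hj]
    · refine ⟨q.totalDegree + (Es.sup fun j => (h j).totalDegree) + Is.sup fun j => (g j).totalDegree,
        fun k hk => ⟨0, zI k (by omega), q ^ 2, zQ k (by omega) q (by omega), by simp⟩⟩
    · refine ⟨q.totalDegree + (Es.sup fun j => (h j).totalDegree) + Is.sup fun j => (g j).totalDegree,
        fun k hk => ⟨0, zI k (by omega), g j * q ^ 2, 
          ⟨0, fun i => if i = j then q ^ 2 else 0, isSOS_zero, by simp, fun i hi => ?_, ?_⟩, by simp⟩⟩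
      · have := hI i hi
        have := totalDegree_pow q 2
        dsimp only
        split_ifs
        · exact ⟨isSOS_sq q, by omega⟩
        · exact ⟨isSOS_zero, by simp; omega⟩
      · simp [hj]
  | zero => 
    exact ⟨(Es.sup fun j => (h j).totalDegree) + Is.sup fun j => (g j).totalDegree, 
      fun k hk => ⟨0, zI k (by omega), 0, zQ0 k (by omega), by simp⟩⟩
  | add x y _ _ hx hy =>
    obtain ⟨a, ha⟩ := hx
    obtain ⟨b, hb⟩ := hy
    refine ⟨max a b, fun k hk => ?_⟩
    obtain ⟨p1, h1, p2, h2, rfl⟩ := ha k (le_trans (le_max_left _ _) hk)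
    obtain ⟨q1, h3, q2, h4, rfl⟩ := hb k (le_trans (le_max_right _ _) hk)
    exact ⟨p1 + q1, IdealDeg.add h1 h3, p2 + q2, QModDeg.add h2 h4, by ring⟩

lemma IsSOS.eval_nonneg {p : RPoly N} (hp : IsSOS p) (x : Fin N → ℝ) : 0 ≤ eval x p := by
  obtain ⟨L, rfl⟩ := hp
  induction L with
  | nil => simp
  | cons a L ih => 
    simp only [List.map_cons, List.sum_cons, map_add, map_pow]
    have := sq_nonneg (eval x a)
    linarith

lemma deg_eval {k : ℕ} {p1 p2 : RPoly N} (h1 : p1 ∈ IdealDeg Es h k) (h2 : p2 ∈ QModDeg Is g k)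
    {x : Fin N → ℝ} (hx : x ∈ Kf Es h Is g) : 0 ≤ eval x (p1 + p2) := by
  obtain ⟨q, -, rfl⟩ := h1
  obtain ⟨s0, s, hs0, -, hs, rfl⟩ := h2
  simp only [map_add, map_sum, map_mul]
  rw [Finset.sum_eq_zero fun j hj => by rw [hx.1 j hj, zero_mul], zero_add]
  exact add_nonneg (hs0.eval_nonneg x) (Finset.sum_nonneg fun j hj => 
    mul_nonneg (hx.2 j hj) ((hs j hj).1.eval_nonneg x))

lemma point_PSD {x : Fin N → ℝ} (hx : x ∈ Kf Es h Is g) {r : ℝ} (hr : 0 ≤ r) (k : ℕ) :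
    MomRelaxPSD Es h Is g k (fun α => r * ∏ i, x i ^ α i) := by
  refine ⟨fun j hj p _ => ?_, fun j hj p _ => ?_, fun p _ => ?_⟩
  · rw [pairing_point, map_mul, hx.1 j hj]; ring
  · rw [pairing_point, map_mul, map_pow]
    exact mul_nonneg hr (mul_nonneg (hx.2 j hj) (sq_nonneg _))
  · rw [pairing_point, map_pow]; exact mul_nonneg hr (sq_nonneg _)

end PartI

section PartJ
variable {N : ℕ} {ι κ : Type} {Es : Finset ι} {h : ι → RPoly N} {Is : Finset κ} {g : κ → RPoly N}

lemma mdeg_le {p : RPoly N} {α : Fin N →₀ ℕ} (hα : α ∈ p.support) : mdeg α ≤ p.totalDegree := by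
  have := le_totalDegree hα
  rwa [Finsupp.sum_fintype _ _ (fun _ => rfl)] at this

lemma totalDegree_mono_le (α : Fin N →₀ ℕ) (r : ℝ) : (monomial α r : RPoly N).totalDegree ≤ mdeg α := by
  refine (totalDegree_monomial_le _ _).trans_eq ?_
  rw [Finsupp.sum_fintype _ _ (fun _ => rfl)]; rfl

lemma expand_deg {s : ℕ} {p : RPoly N} (hp : p.totalDegree ≤ s) :
    p = ∑ γ : {α : Fin N →₀ ℕ // mdeg α ≤ s}, monomial γ.1 (p.coeff γ.1) := by
  classical
  conv_lhs => rw [p.as_sum]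
  symm
  rw [← Finset.sum_subtype_of_mem (p := fun α => mdeg α ≤ s) (fun γ => monomial γ (p.coeff γ))
    (fun α hα => (mdeg_le hα).trans hp)]
  symm
  refine Finset.sum_subset (Finset.subset_univ _) fun γ _ hγ => ?_
  rw [Finset.mem_subtype, notMem_support_iff] at hγ
  rw [hγ, map_zero]

lemma CS {k : ℕ} {w : (Fin N →₀ ℕ) → ℝ} (hw : MomRelaxPSD Es h Is g k w) {b q : RPoly N}
    (hb : b.totalDegree ≤ k) (hq : q.totalDegree ≤ k) (h0 : pairL w (b ^ 2) = 0) : pairL w (b * q) = 0 := by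
  have key : ∀ s : ℝ, 0 ≤ pairL w (q ^ 2) + 2 * s * pairL w (b * q) := by
    intro s
    have := hw.2.2 (q + C s * b) ?_
    · rw [← pairL_apply] at this
      have e : (q + C s * b) ^ 2 = q ^ 2 + C (2 * s) * (b * q) + C (s ^ 2) * b ^ 2 := by
        rw [C_mul, C_pow, show (C 2 : RPoly N) = 2 from map_ofNat C 2]; ring
      rw [e, map_add, map_add, pairL_C_mul, pairL_C_mul, h0] at this
      linarith
    · refine (totalDegree_add _ _).trans (max_le hq ?_)
      exact (totalDegree_mul _ _).trans (by simpa using hb)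
  by_contra hne
  have := key (-(pairL w (q ^ 2) + 1) / (2 * pairL w (b * q)))
  have e : 2 * (-(pairL w (q ^ 2) + 1) / (2 * pairL w (b * q))) * pairL w (b * q) = -(pairL w (q ^ 2) + 1) := by
    field_simp
  rw [e] at this
  linarith

lemma flat_of (F : RPoly N) (S : Finset (Fin N → ℝ))
    (hS : ∀ b : RPoly N, (∀ u ∈ S, eval u b = 0) → ∃ c : ℝ, 0 < c ∧ C c * F - b ^ 2 ∈ MM Es h Is g)
    (d0 dK : ℕ) : ∃ k1 : ℕ, ∀ k, k1 ≤ k → ∀ w, MomRelaxPSD Es h Is g k w → pairing F w = 0 →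
      HasFlatTruncation d0 dK k w := by
  classical
  have hd : ∀ u, ∃ e : RPoly N, u ∈ S → eval u e = 1 ∧ ∀ v ∈ S, v ≠ u → eval v e = 0 := by
    intro u
    by_cases hu : u ∈ S
    · obtain ⟨e, he⟩ := delta S u hu
      exact ⟨e, fun _ => he⟩
    · exact ⟨0, fun h => absurd h hu⟩
  choose e he using hd
  obtain ⟨D, hD⟩ : ∃ D, D = S.sup fun u => (e u).totalDegree := ⟨_, rfl⟩
  obtain ⟨t, ht⟩ : ∃ t, t = max d0 (D + dK) := ⟨_, rfl⟩
  have htD : D ≤ t - dK := by omega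
  let r : (Fin N →₀ ℕ) → RPoly N := fun α => ∑ u ∈ S, C (∏ i, u i ^ α i) * e u
  have hr : ∀ α, (r α).totalDegree ≤ D := by
    intro α
    refine totalDegree_finsetSum_le fun u hu => ?_
    refine (totalDegree_mul _ _).trans ?_
    rw [totalDegree_C, zero_add, hD]
    exact Finset.le_sup (f := fun u => (e u).totalDegree) hu
  let b : (Fin N →₀ ℕ) → RPoly N := fun α => monomial α 1 - r α
  have hb : ∀ α, ∀ u ∈ S, eval u (b α) = 0 := by
    intro α u hu
    simp only [b, r, map_sub, map_sum, map_mul, eval_C, eval_monomial, one_mul]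
    rw [Finset.sum_eq_single u, (he u hu).1, mul_one, Finsupp.prod_fintype _ _ (fun _ => pow_zero _), sub_self]
    · intro v hv hne
      rw [(he v hv).2 u hu hne.symm, mul_zero]
    · intro h; exact absurd hu h
  have hk : ∀ α, ∃ c : ℝ, 0 < c ∧ ∃ k0 : ℕ, ∀ k, k0 ≤ k → ∀ w, MomRelaxPSD Es h Is g k w → 
      0 ≤ pairing (C c * F - b α ^ 2) w := by
    intro α
    obtain ⟨c, hc, hm⟩ := hS (b α) (hb α)
    exact ⟨c, hc, mm_pair hm⟩
  choose c hc k0 hk0 using hk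
  refine ⟨max t (Finset.univ.sup fun α : {α : Fin N →₀ ℕ // mdeg α ≤ t} => k0 α.1), fun k hkk w hw hF => ?_⟩
  have htk : t ≤ k := le_trans (le_max_left _ _) hkk
  have hk0k : ∀ α : {α : Fin N →₀ ℕ // mdeg α ≤ t}, k0 α.1 ≤ k := fun α =>
    le_trans (Finset.le_sup (f := fun α : {α : Fin N →₀ ℕ // mdeg α ≤ t} => k0 α.1) (Finset.mem_univ α))
      (le_trans (le_max_right _ _) hkk)
  have hmon : ∀ α : {α : Fin N →₀ ℕ // mdeg α ≤ t}, (monomial α.1 (1 : ℝ) : RPoly N).totalDegree ≤ k := fun α =>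
    (totalDegree_mono_le _ _).trans (α.2.trans htk)
  have hrk : ∀ α, (r α).totalDegree ≤ k := fun α => (hr α).trans (by omega)
  have hbd : ∀ α : {α : Fin N →₀ ℕ // mdeg α ≤ t}, (b α.1).totalDegree ≤ k := fun α =>
    (totalDegree_sub _ _).trans (max_le (hmon α) (hrk _))
  have hb0 : ∀ α : {α : Fin N →₀ ℕ // mdeg α ≤ t}, pairL w (b α.1 ^ 2) = 0 := by
    intro α
    have h1 := hk0 α.1 k (hk0k α) w hw
    rw [← pairL_apply, map_sub, pairL_C_mul, pairL_apply w F, hF] at h1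
    have h2 := hw.2.2 (b α.1) (hbd α)
    rw [← pairL_apply] at h2
    linarith
  have hkey : ∀ α β : {α : Fin N →₀ ℕ // mdeg α ≤ t}, w (α.1 + β.1) = pairL w (r α.1 * r β.1) := by
    intro α β
    have h1 := CS hw (hbd α) (hmon β) (hb0 α)
    have h2 := CS hw (hbd β) (hrk α.1) (hb0 β)
    simp only [b, sub_mul, map_sub] at h1 h2
    rw [monomial_mul, pairL_monomial] at h1
    rw [mul_comm (monomial β.1 1), mul_comm (r β.1)] at h2
    linarith
  let B : Matrix {α : Fin N →₀ ℕ // mdeg α ≤ t} {α : Fin N →₀ ℕ // mdeg α ≤ t - dK} ℝ :=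
    fun α γ => (r α.1).coeff γ.1
  have hM : momentMatrix t w = B * momentMatrix (t - dK) w * B.transpose := by
    ext α β
    have e1 : momentMatrix t w α β = pairL w (r α.1 * r β.1) := hkey α β
    rw [e1]
    conv_lhs => rw [expand_deg ((hr α.1).trans htD), expand_deg ((hr β.1).trans htD)]
    rw [Finset.sum_mul_sum]
    simp only [map_sum, monomial_mul, pairL_monomial]
    have e2 : ∀ γ, (B * momentMatrix (t - dK) w) α γ = ∑ δ : {α : Fin N →₀ ℕ // mdeg α ≤ t - dK}, (r α.1).coeff δ.1 * w (δ.1 + γ.1) :=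
      fun γ => Matrix.mul_apply
    have e3 : (B * momentMatrix (t - dK) w * B.transpose) α β =
        ∑ γ, (B * momentMatrix (t - dK) w) α γ * (r β.1).coeff γ.1 := Matrix.mul_apply
    rw [e3, Finset.sum_comm]
    refine Finset.sum_congr rfl fun γ _ => ?_
    rw [e2, Finset.sum_mul]
    exact Finset.sum_congr rfl fun δ _ => by ring
  refine ⟨t, by omega, htk, le_antisymm ?_ ?_⟩
  · have hsub : ∀ α : {α : Fin N →₀ ℕ // mdeg α ≤ t - dK}, mdeg α.1 ≤ t := fun α => α.2.trans (Nat.sub_le _ _)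
    have : momentMatrix (t - dK) w = (momentMatrix t w).submatrix (fun α => ⟨α.1, hsub α⟩) (fun α => ⟨α.1, hsub α⟩) := rfl
    rw [this]
    exact Matrix.rank_submatrix_le _ _ _
  · rw [hM]
    exact (Matrix.rank_mul_le_left _ _).trans (Matrix.rank_mul_le_right _ _)

end PartJ

section PartK
variable {n : ℕ}

lemma eval_homogAux (ℓ : ℕ) (p : RPoly n) (hp : p.totalDegree ≤ ℓ) (x : Fin (n + 1) → ℝ) (hx : x 0 ≠ 0) :
    eval x (homogAux ℓ p) = x 0 ^ ℓ * eval (fun i => x i.succ / x 0) p := by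
  classical
  rw [homogAux, map_sum, eval_eq', Finset.mul_sum]
  refine Finset.sum_congr rfl fun α hα => ?_
  have hd : mdeg α ≤ ℓ := (mdeg_le hα).trans hp
  rw [eval_monomial, Finsupp.prod_fintype _ _ (fun _ => pow_zero _), Fin.prod_univ_succ]
  have e0 : (Finsupp.single (0 : Fin (n + 1)) (ℓ - mdeg α) + Finsupp.mapDomain Fin.succ α) 0 = ℓ - mdeg α := by
    rw [Finsupp.add_apply, Finsupp.single_eq_same, Finsupp.mapDomain_of_notMem_range _ _ (by simp), add_zero]
  have e1 : ∀ i : Fin n, (Finsupp.single (0 : Fin (n + 1)) (ℓ - mdeg α) + Finsupp.mapDomain Fin.succ α) i.succ = α i := by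
    intro i
    rw [Finsupp.add_apply, Finsupp.mapDomain_apply (Fin.succ_injective n), Finsupp.single_eq_of_ne (Fin.succ_ne_zero i), zero_add]
  simp only [e0, e1, div_pow, Finset.prod_div_distrib, Finset.prod_pow_eq_pow_sum]
  rw [show ∑ i, α i = mdeg α from rfl, pow_sub₀ _ hx hd]
  field_simp

lemma eval_homogenize (p : RPoly n) (x : Fin (n + 1) → ℝ) (hx : x 0 ≠ 0) :
    eval x (homogenize p) = x 0 ^ p.totalDegree * eval (fun i => x i.succ / x 0) p :=
  eval_homogAux _ _ le_rfl _ hx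

lemma Khom_eq (E I : Finset ℕ) (c : ℕ → RPoly n) : Khom E I c = Kf (OS E) (gEqH c) (OS I) (gInH c) := by
  ext x
  simp only [Khom, Kf, OS, gEqH, gInH, sphereP, Set.mem_ofPred_eq, Finset.forall_mem_insert, Finset.forall_mem_image,
    Option.elim, map_sub, map_sum, map_pow, eval_X, map_one, sub_eq_zero]
  tauto

lemma Khom_to_K {E I : Finset ℕ} {c : ℕ → RPoly n} {x : Fin (n + 1) → ℝ} (hx : x ∈ Khom E I c) (h0 : 0 < x 0) :
    (fun i => x i.succ / x 0) ∈ Kset E I c := by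
  refine ⟨fun j hj => ?_, fun j hj => ?_⟩
  · have := hx.1 j hj
    rw [eval_homogenize _ _ h0.ne'] at this
    exact (mul_eq_zero.1 this).resolve_left (pow_ne_zero _ h0.ne')
  · have := hx.2.1 j hj
    rw [eval_homogenize _ _ h0.ne'] at this
    exact nonneg_of_mul_nonneg_right this (pow_pos h0 _)

lemma K_to_Khom {E I : Finset ℕ} {c : ℕ → RPoly n} {y : Fin n → ℝ} (hy : y ∈ Kset E I c) :
    ∃ x ∈ Khom E I c, 0 < x 0 ∧ (fun i : Fin n => x i.succ / x 0) = y := by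
  obtain ⟨s, hs⟩ : ∃ s, s = 1 + ∑ i, y i ^ 2 := ⟨_, rfl⟩
  have hs0 : 0 < s := by rw [hs]; positivity
  obtain ⟨r, hr⟩ : ∃ r, r = (Real.sqrt s)⁻¹ := ⟨_, rfl⟩
  have hr0 : 0 < r := by rw [hr]; exact inv_pos.2 (Real.sqrt_pos.2 hs0)
  have hr2 : r ^ 2 * s = 1 := by rw [hr, inv_pow, Real.sq_sqrt hs0.le]; field_simp
  let x : Fin (n + 1) → ℝ := Fin.cons r (fun i => r * y i)
  have hx0 : x 0 = r := rfl
  have hxs : ∀ i : Fin n, x i.succ = r * y i := fun i => rfl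
  have hxy : (fun i : Fin n => x i.succ / x 0) = y := by
    ext i; rw [hxs, hx0]; field_simp
  have hxne : x 0 ≠ 0 := by rw [hx0]; exact hr0.ne'
  refine ⟨x, ⟨fun j hj => ?_, fun j hj => ?_, ?_, ?_⟩, by rw [hx0]; exact hr0, hxy⟩
  · rw [eval_homogenize _ _ hxne, hxy, hy.1 j hj, mul_zero]
  · rw [eval_homogenize _ _ hxne, hxy, hx0]
    exact mul_nonneg (pow_nonneg hr0.le _) (hy.2 j hj)
  · rw [Fin.sum_univ_succ]
    simp only [hxs, hx0, mul_pow]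
    rw [← Finset.mul_sum, ← hr2, hs]; ring
  · rw [hx0]; exact hr0.le

end PartK

/-- Theorem 4.4: finite convergence of the homogenized Moment-SOS
hierarchy for polynomial optimization with unbounded sets, plus flat truncation of
the minimizers of the moment relaxations. -/
theorem statement_8
    (n d : ℕ) (E I : Finset ℕ) (hEI : Disjoint E I) (c : ℕ → RPoly n)
    (f : RPoly n) (hfd : f.totalDegree = d)
    -- K is closed at infinity
    (hcl : ClosedAtInfinity E I c)
    -- f ∈ ℝ + int(P_d(K))
    (hint : ∃ cst : ℝ, (f - C cst) ∈ PdInterior d (Kset E I c))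
    -- f_min is the (finite) optimal value of (POP)
    (fmin : ℝ) (hfmin : IsGLB {v : ℝ | ∃ x ∈ Kset E I c, v = eval x f} fmin)
    -- LICQC, SCC, SOSC at every global minimizer of (H)
    (hopt : ∀ u : Fin (n + 1) → ℝ,
      (u ∈ Khom E I c ∧ ∀ x ∈ Khom E I c,
        eval u (homogenize f - C fmin * (X 0 : RPoly (n + 1)) ^ d)
          ≤ eval x (homogenize f - C fmin * (X 0 : RPoly (n + 1)) ^ d)) →
      OptCondsAt (OS E) (gEqH c) (OS I) (gInH c)
        (homogenize f - C fmin * (X 0 : RPoly (n + 1)) ^ d) u) :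
    (∃ k0 : ℕ, ∀ k : ℕ, k0 ≤ k →
      -- f_k = f_min
      sSup {γ : ℝ | ∃ p1 ∈ IdealDeg (OS E) (gEqH c) (2 * k),
          ∃ p2 ∈ QModDeg (OS I) (gInH c) (2 * k),
          homogenize f - C γ * (X 0 : RPoly (n + 1)) ^ d = p1 + p2} = fmin ∧
      -- f'_k = f_min
      sInf {v : ℝ | ∃ w : (Fin (n + 1) →₀ ℕ) → ℝ,
          (pairing ((X 0 : RPoly (n + 1)) ^ d) w = 1 ∧
            MomRelaxPSD (OS E) (gEqH c) (OS I) (gInH c) k w) ∧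
          v = pairing (homogenize f) w} = fmin) ∧
    (∃ k1 : ℕ, ∀ k : ℕ, k1 ≤ k →
      ∀ w : (Fin (n + 1) →₀ ℕ) → ℝ,
        (pairing ((X 0 : RPoly (n + 1)) ^ d) w = 1 ∧
          MomRelaxPSD (OS E) (gEqH c) (OS I) (gInH c) k w) →
        (∀ w' : (Fin (n + 1) →₀ ℕ) → ℝ,
          (pairing ((X 0 : RPoly (n + 1)) ^ d) w' = 1 ∧
            MomRelaxPSD (OS E) (gEqH c) (OS I) (gInH c) k w') →
          pairing (homogenize f) w ≤ pairing (homogenize f) w') →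
        HasFlatTruncation (max ((d + 1) / 2) (dKHom E I c)) (dKHom E I c) k w) := by
  obtain ⟨F, hFdef⟩ : ∃ F, F = homogenize f - C fmin * (X 0 : RPoly (n + 1)) ^ d := ⟨_, rfl⟩
  rw [← hFdef] at hopt
  have hs : ∃ j ∈ OS E, gEqH c j = (∑ i, X i ^ 2) - 1 := ⟨none, by simp [OS], rfl⟩
  have hlow : ∀ y ∈ Kset E I c, fmin ≤ eval y f := fun y hy => hfmin.1 ⟨y, hy, rfl⟩
  have heF : ∀ x : Fin (n + 1) → ℝ, 0 < x 0 → ∀ γ : ℝ,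
      eval x (homogenize f - C γ * (X 0 : RPoly (n + 1)) ^ d)
        = x 0 ^ d * (eval (fun i => x i.succ / x 0) f - γ) := by
    intro x hx γ
    rw [map_sub, eval_homogenize _ _ hx.ne', hfd]
    simp only [map_mul, map_pow, eval_C, eval_X]
    ring
  have hFnn : ∀ x ∈ Khom E I c, 0 ≤ eval x F := by
    intro x hx
    rw [hcl] at hx
    have hc : IsClosed {x : Fin (n + 1) → ℝ | 0 ≤ eval x F} :=
      isClosed_le continuous_const (MvPolynomial.continuous_eval _)
    refine closure_minimal ?_ hc hx
    rintro z ⟨hz, hz0⟩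
    have hz0' : 0 < z 0 := hz0
    show 0 ≤ eval z F
    rw [hFdef, heF z hz0']
    exact mul_nonneg (pow_nonneg hz0'.le _) (sub_nonneg.2 (hlow _ (Khom_to_K hz hz0')))
  obtain ⟨S, hS⟩ := core hs F (fun x hx => hFnn x (by rw [Khom_eq]; exact hx))
    (fun u hu hu0 => hopt u ⟨by rw [Khom_eq]; exact hu, fun x hx => by rw [hu0]; exact hFnn x hx⟩)
  have hFM : F ∈ MM (OS E) (gEqH c) (OS I) (gInH c) := by
    obtain ⟨a, ha, hm⟩ := hS 0 (by simp)
    have := (MM_good (Is := OS I) (g := gInH c) hs).smul (r := a⁻¹) (inv_pos.2 ha).le hm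
    rw [zero_pow two_ne_zero, sub_zero, ← mul_assoc, ← C_mul, inv_mul_cancel₀ ha.ne', C_1, one_mul] at this
    exact this
  obtain ⟨ka, hka⟩ := mm_deg hFM
  obtain ⟨kb, hkb⟩ := mm_pair hFM
  have hpF : ∀ w, pairing ((X 0 : RPoly (n + 1)) ^ d) w = 1 → pairing F w = pairing (homogenize f) w - fmin := by
    intro w hw
    rw [← pairL_apply, hFdef, map_sub, pairL_C_mul, pairL_apply, pairL_apply, hw, mul_one]
  have hfeas : ∀ k : ℕ, ∀ y ∈ Kset E I c, ∃ w : (Fin (n + 1) →₀ ℕ) → ℝ,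
      (pairing ((X 0 : RPoly (n + 1)) ^ d) w = 1 ∧
        MomRelaxPSD (OS E) (gEqH c) (OS I) (gInH c) k w) ∧ pairing (homogenize f) w = eval y f := by
    intro k y hy
    obtain ⟨x, hx, hx0, hxy⟩ := K_to_Khom hy
    have hp : 0 < x 0 ^ d := pow_pos hx0 d
    refine ⟨fun α => (x 0 ^ d)⁻¹ * ∏ i, x i ^ α i, ⟨?_, point_PSD (by rw [← Khom_eq]; exact hx) (inv_pos.2 hp).le k⟩, ?_⟩
    · rw [pairing_point, map_pow, eval_X, inv_mul_cancel₀ hp.ne']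
    · rw [pairing_point, eval_homogenize _ _ hx0.ne', hxy, hfd, ← mul_assoc, inv_mul_cancel₀ hp.ne', one_mul]
  constructor
  · refine ⟨max ka kb, fun k hk => ⟨?_, ?_⟩⟩
    · refine IsGreatest.csSup_eq ⟨?_, ?_⟩
      · obtain ⟨p1, h1, p2, h2, e⟩ := hka k (le_trans (le_max_left _ _) hk)
        exact ⟨p1, h1, p2, h2, by rw [← hFdef, e]⟩
      · rintro γ ⟨p1, h1, p2, h2, e⟩
        refine hfmin.2 ?_
        rintro v ⟨y, hy, rfl⟩
        obtain ⟨x, hx, hx0, hxy⟩ := K_to_Khom hy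
        have := deg_eval h1 h2 (x := x) (by rw [← Khom_eq]; exact hx)
        rw [← e, heF x hx0, hxy] at this
        exact sub_nonneg.1 (nonneg_of_mul_nonneg_right this (pow_pos hx0 _))
    · have hne := hfmin.nonempty
      refine IsGLB.csInf_eq ⟨?_, ?_⟩ ?_
      · rintro v ⟨w, ⟨hw1, hw2⟩, rfl⟩
        have := hkb k (le_trans (le_max_right _ _) hk) w hw2
        rw [hpF w hw1] at this
        linarith
      · intro l hl
        refine hfmin.2 ?_
        rintro v ⟨y, hy, rfl⟩
        obtain ⟨w, hw, e⟩ := hfeas k y hy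
        exact hl ⟨w, hw, e.symm⟩
      · obtain ⟨v, y, hy, rfl⟩ := hne
        obtain ⟨w, hw, e⟩ := hfeas k y hy
        exact ⟨_, w, hw, e.symm⟩
  · obtain ⟨k1, hk1⟩ := flat_of F S hS (max ((d + 1) / 2) (dKHom E I c)) (dKHom E I c)
    refine ⟨max k1 kb, fun k hk w hw hmin => hk1 k (le_trans (le_max_left _ _) hk) w hw.2 ?_⟩
    have h1 := hkb k (le_trans (le_max_right _ _) hk) w hw.2
    rw [hpF w hw.1] at h1 ⊢
    have h2 : pairing (homogenize f) w ≤ fmin := by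
      refine hfmin.2 ?_
      rintro v ⟨y, hy, rfl⟩
      obtain ⟨w', hw', e⟩ := hfeas k y hy
      exact (hmin w' hw').trans_eq e
    linarith
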